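/- Let n ≥ 2 and let f : S^n → S^n be a continuous map satisfying f(−p) = R_p f(p) for all p ∈ S^n, where R_p(x) = x − 2(p·x)p. Then f is not homotopic to a constant map; moreover, if n is odd, f is homotopic to the identity map of S^n. -/

import Mathlib

open Metric
open scoped RealInnerProductSpace

noncomputable section

/-- Ambient Euclidean space `ℝ^{n+1}`. -/
abbrev Eu (n : ℕ) : Type := EuclideanSpace ℝ (Fin (n + 1))

/-- The unit sphere `S^n` as a subtype. -/
abbrev Sph (n : ℕ) := Metric.sphere (0 : Eu n) 1

/-- The reflection `R_p(x) = x - 2(p·x)p` with respect to the hyperplane orthogonal to `p`. -/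
def Refl {n : ℕ} (p x : Eu n) : Eu n := x - (2 * ⟪p, x⟫) • p

open MeasureTheory Set Filter Topology

theorem ContDiff.continuous_det_fderiv {E : Type*} [NormedAddCommGroup E]
    [NormedSpace ℝ E] {G : E → E} (hG : ContDiff ℝ 1 G) :
    Continuous fun x => (fderiv ℝ G x).det :=
  ContinuousLinearMap.continuous_det.comp (hG.continuous_fderiv one_ne_zero)

theorem fderiv_eq_one_of_norm_lt {E : Type*} [NormedAddCommGroup E] [NormedSpace ℝ E] {G : E → E}
    {ρ : ℝ} (hρ : ∀ x, ρ ≤ ‖x‖ → G x = x) {x : E} (hx : ρ < ‖x‖) : fderiv ℝ G x = 1 := by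
  have : G =ᶠ[𝓝 x] id := by
    filter_upwards [(isOpen_lt continuous_const continuous_norm).mem_nhds hx] with y hy
    exact hρ y (le_of_lt hy)
  rw [this.fderiv_eq, fderiv_id]; rfl

theorem ContDiff.exists_isOpen_injOn_det_fderiv {E : Type*} [NormedAddCommGroup E]
    [NormedSpace ℝ E] [FiniteDimensional ℝ E] {G : E → E} (hG : ContDiff ℝ 1 G) {z : E}
    (hz : (fderiv ℝ G z).det ≠ 0) :
    ∃ U, IsOpen U ∧ z ∈ U ∧ InjOn G U ∧ (∀ V, IsOpen V → z ∈ V → G '' V ∈ 𝓝 (G z)) ∧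
      ∀ x ∈ U, SignType.sign (fderiv ℝ G x).det = SignType.sign (fderiv ℝ G z).det := by
  let A : E ≃L[ℝ] E := (LinearEquiv.ofIsUnitDet (f := (fderiv ℝ G z : E →ₗ[ℝ] E))
    (v := Module.finBasis ℝ E) (v' := Module.finBasis ℝ E)
    (by rw [LinearMap.det_toMatrix]; exact isUnit_iff_ne_zero.2 hz)).toContinuousLinearEquiv
  have hA : HasStrictFDerivAt G (A : E →L[ℝ] E) z := by
    convert! hG.contDiffAt.hasStrictFDerivAt (x := z) one_ne_zero
  let e := hA.toOpenPartialHomeomorph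
  have hS : IsOpen {x | 0 < (fderiv ℝ G x).det * (fderiv ℝ G z).det} :=
    isOpen_lt continuous_const (hG.continuous_det_fderiv.mul continuous_const)
  refine ⟨e.source ∩ {x | 0 < (fderiv ℝ G x).det * (fderiv ℝ G z).det}, e.open_source.inter hS,
    ⟨hA.mem_toOpenPartialHomeomorph_source, mul_self_pos.2 hz⟩, e.injOn.mono inter_subset_left,
    fun V hV hzV => ?_, fun x hx => ?_⟩
  · rw [← hA.map_nhds_eq_of_equiv]
    exact image_mem_map (hV.mem_nhds hzV)
  · have := hx.2
    simp only [mem_ofPred_eq] at this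
    rcases pos_and_pos_or_neg_and_neg_of_mul_pos this with ⟨h1, h2⟩ | ⟨h1, h2⟩
    · rw [sign_pos h1, sign_pos h2]
    · rw [sign_neg h1, sign_neg h2]

section Degree

variable {E : Type*} [NormedAddCommGroup E] [NormedSpace ℝ E] [FiniteDimensional ℝ E]

theorem ContinuousLinearMap.det_one_add_pos {A : E →L[ℝ] E} (hA : ‖A‖ < 1) :
    0 < (1 + A).det := by
  have hne : ∀ s ∈ Icc (0 : ℝ) 1, (1 + s • A).det ≠ 0 := by
    intro s hs h0
    have hn : ‖-(s • A)‖ < 1 := by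
      rw [norm_neg, norm_smul, Real.norm_of_nonneg hs.1]
      nlinarith [hs.2, norm_nonneg A]
    have hu : IsUnit (1 - (-(s • A))) := isUnit_one_sub_of_norm_lt_one hn
    rw [sub_neg_eq_add] at hu
    have h1 := hu.map (ContinuousLinearMap.toLinearMapRingHom (R₁ := ℝ) (M₁ := E))
    have h2 := (LinearMap.isUnit_iff_isUnit_det _).1 h1
    exact h2.ne_zero h0
  have hc : ContinuousOn (fun s : ℝ => (1 + s • A).det) (Icc 0 1) := by
    exact ((ContinuousLinearMap.continuous_det (𝕜 := ℝ) (E := E)).comp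
      (by fun_prop : Continuous fun s : ℝ => 1 + s • A)).continuousOn
  by_contra hneg
  have := intermediate_value_Icc' zero_le_one hc
  obtain ⟨s, hs, h0⟩ := this (show (0 : ℝ) ∈ _ from ⟨by simpa using hneg, by
    simp [ContinuousLinearMap.det]⟩)
  exact hne s hs h0

theorem LinearMap.exists_polynomial_eval_eq_det_one_add_smul (A : E →ₗ[ℝ] E) :
    ∃ q : Polynomial ℝ, q.degree ≤ (Module.finrank ℝ E : ℕ) ∧
      ∀ t, q.eval t = LinearMap.det (1 + t • A) := by
  classical
  let b := Module.finBasis ℝ E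
  let M := LinearMap.toMatrix b b A
  refine ⟨((Polynomial.X : Polynomial ℝ) • M.map Polynomial.C
    + (1 : Matrix _ _ ℝ).map Polynomial.C).det, ?_, fun t => ?_⟩
  · refine Polynomial.degree_le_of_natDegree_le ?_
    simpa using Polynomial.natDegree_det_X_add_C_le M 1
  · rw [← LinearMap.det_toMatrix b, ← Polynomial.coe_evalRingHom, RingHom.map_det]
    congr 1
    ext i j
    rcases eq_or_ne i j with rfl | hij
    · simp [M, LinearMap.toMatrix_one, add_comm]; exact mul_comm _ _
    · simp [M, LinearMap.toMatrix_one, hij]; exact mul_comm _ _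

variable [MeasurableSpace E] [BorelSpace E] (μ : Measure E) [μ.IsAddHaarMeasure]

theorem setIntegral_det_one_add_smul_of_small {u : E → E} (hu : ContDiff ℝ 1 u) {R : ℝ}
    (hR : ∀ x, R ≤ ‖x‖ → u x = 0) {K : NNReal} (hK : LipschitzWith K u) {t : ℝ} (ht : 0 ≤ t)
    (htK : t * K < 1) :
    ∫ x in closedBall (0 : E) R, (1 + t • fderiv ℝ u x).det ∂μ = μ.real (closedBall (0 : E) R) := by
  lift t to NNReal using ht
  have ht : (0 : ℝ) ≤ t := t.2
  let g : E → E := fun x => x + (t : ℝ) • u x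
  have hd : ∀ x, HasFDerivAt g (1 + (t : ℝ) • fderiv ℝ u x) x := fun x =>
    (hasFDerivAt_id x).add (((hu.differentiable one_ne_zero) x).hasFDerivAt.const_smul t)
  have hpos : ∀ x, 0 < (1 + (t : ℝ) • fderiv ℝ u x).det := fun x => by
    apply ContinuousLinearMap.det_one_add_pos
    rw [norm_smul, Real.norm_of_nonneg ht]
    refine lt_of_le_of_lt ?_ htK
    gcongr
    exact norm_fderiv_le_of_lipschitz ℝ hK
  have happ : ApproximatesLinearOn g ((ContinuousLinearEquiv.refl ℝ E : E ≃L[ℝ] E) : E →L[ℝ] E)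
      univ (t * K) := by
    rw [ApproximatesLinearOn.approximatesLinearOn_iff_lipschitzOnWith]
    have : LipschitzWith (t * K) (g - ⇑((ContinuousLinearEquiv.refl ℝ E : E ≃L[ℝ] E) : E →L[ℝ] E)) := by
      have h1 : (g - ⇑((ContinuousLinearEquiv.refl ℝ E : E ≃L[ℝ] E) : E →L[ℝ] E)) = fun x => (t : ℝ) • u x := by
        ext x; simp [g]
      rw [h1]
      refine LipschitzWith.of_dist_le_mul fun x y => ?_
      rw [dist_smul₀, Real.norm_of_nonneg ht]
      have := hK.dist_le_mul x y
      push_cast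
      rw [mul_assoc]
      exact mul_le_mul_of_nonneg_left this ht
    exact this.lipschitzOnWith
  have hc : Subsingleton E ∨ (t * K : NNReal) <
      ‖((ContinuousLinearEquiv.refl ℝ E).symm : E →L[ℝ] E)‖₊⁻¹ := by
    rcases subsingleton_or_nontrivial E with h | h
    · exact Or.inl h
    · right
      have : ‖((ContinuousLinearEquiv.refl ℝ E).symm : E →L[ℝ] E)‖₊ = 1 := by
        ext; simp
      rw [this, inv_one, ← NNReal.coe_lt_coe]
      exact htK
  have hsurj : Function.Surjective g := happ.surjective hc
  have hinj : Function.Injective g := injOn_univ.1 (happ.injOn hc)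
  have hout : ∀ x, R < ‖x‖ → g x = x := fun x hx => by simp [g, hR x hx.le]
  have himg : g '' closedBall 0 R = closedBall 0 R := by
    ext y
    obtain ⟨x, rfl⟩ := hsurj y
    rw [hinj.mem_set_image]
    simp only [mem_closedBall, dist_zero_right]
    constructor
    · intro hx
      by_contra hy
      exact hy (by rwa [hinj (hout (g x) (not_le.1 hy))])
    · intro hy
      by_contra hx
      rw [hout x (not_le.1 hx)] at hy
      exact hx hy
  have := integral_image_eq_integral_abs_det_fderiv_smul μ (s := closedBall (0 : E) R)
    measurableSet_closedBall (fun x _ => (hd x).hasFDerivWithinAt) hinj.injOn (fun _ => (1 : ℝ))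
  rw [himg] at this
  simp only [smul_eq_mul, mul_one, abs_of_pos (hpos _)] at this
  rw [← this]; simp [Measure.real]

theorem setIntegral_det_one_add {u : E → E} (hu : ContDiff ℝ 1 u) {R : ℝ}
    (hR : ∀ x, R ≤ ‖x‖ → u x = 0) :
    ∫ x in closedBall (0 : E) R, (1 + fderiv ℝ u x).det ∂μ = μ.real (closedBall (0 : E) R) := by
  classical
  obtain ⟨K, hK⟩ := hu.lipschitzWith_of_hasCompactSupport
    (HasCompactSupport.intro (isCompact_closedBall (0 : E) R) fun x hx => hR x (by
      simp only [mem_closedBall, dist_zero_right, not_le] at hx; exact hx.le)) one_ne_zero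
  set d := Module.finrank ℝ E
  let v : ℕ → ℝ := fun j => 1 / ((K + 1) * (j + 1))
  have hv0 : ∀ j, 0 ≤ v j := fun j => by positivity
  have hvK : ∀ j, v j * K < 1 := fun j => by
    simp only [v]
    rw [one_div_mul_eq_div, div_lt_one (by positivity)]
    have : (0:ℝ) ≤ K := K.2
    have : (0:ℝ) ≤ j := j.cast_nonneg
    nlinarith
  have hvinj : InjOn v (Finset.range (d + 1)) := by
    intro i _ j _ hij
    simp only [v, one_div, inv_inj] at hij
    have hp : ((K : ℝ) + 1) ≠ 0 := by positivity
    have := mul_left_cancel₀ hp hij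
    exact_mod_cast add_right_cancel this
  let w : ℕ → ℝ := fun j => (Lagrange.basis (Finset.range (d + 1)) v j).eval 1
  have hw : ∑ j ∈ Finset.range (d + 1), w j = 1 := by
    simp only [w]
    rw [← Polynomial.eval_finsetSum, Lagrange.sum_basis hvinj (by simp)]
    simp
  have key : ∀ A : E →L[ℝ] E,
      (1 + A).det = ∑ j ∈ Finset.range (d + 1), w j * (1 + v j • A).det := by
    intro A
    obtain ⟨q, hq, hqe⟩ := LinearMap.exists_polynomial_eval_eq_det_one_add_smul (A : E →ₗ[ℝ] E)
    have hi := Lagrange.eq_interpolate hvinj (f := q) (by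
      simp only [Finset.card_range]
      refine lt_of_le_of_lt hq ?_
      exact_mod_cast Nat.lt_succ_self _)
    have h1 := hqe 1
    rw [hi, Lagrange.interpolate_apply, Polynomial.eval_finsetSum] at h1
    simp only [one_smul] at h1
    change LinearMap.det (1 + (A : E →ₗ[ℝ] E)) = _
    rw [← h1]
    refine Finset.sum_congr rfl fun j _ => ?_
    rw [Polynomial.eval_mul, Polynomial.eval_C, hqe, mul_comm]
    rfl
  have hcont : Continuous (fderiv ℝ u) := hu.continuous_fderiv one_ne_zero
  have hsum : (fun x => (1 + fderiv ℝ u x).det) = fun x =>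
      ∑ j ∈ Finset.range (d + 1), w j * (1 + v j • fderiv ℝ u x).det := funext fun x => key _
  rw [hsum, integral_finsetSum]
  · simp_rw [integral_const_mul, setIntegral_det_one_add_smul_of_small μ hu hR hK (hv0 _) (hvK _)]
    rw [← Finset.sum_mul, hw, one_mul]
  · intro j _
    apply Integrable.const_mul
    exact ((ContinuousLinearMap.continuous_det (𝕜 := ℝ) (E := E)).comp
      (by fun_prop : Continuous fun x => 1 + v j • fderiv ℝ u x)).continuousOn.integrableOn_compact
        (isCompact_closedBall _ _)

theorem setIntegral_det_fderiv {G : E → E} (hG : ContDiff ℝ 1 G) {R : ℝ}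
    (hR : ∀ x, R ≤ ‖x‖ → G x = x) :
    ∫ x in closedBall (0 : E) R, (fderiv ℝ G x).det ∂μ = μ.real (closedBall (0 : E) R) := by
  rw [← setIntegral_det_one_add μ (u := fun x => G x - x) (hG.sub contDiff_id) (R := R)
    (fun x hx => by simp [hR x hx])]
  congr 1
  ext x
  rw [fderiv_fun_sub (hG.differentiable one_ne_zero x) differentiableAt_fun_id]
  simp [show ContinuousLinearMap.id ℝ E = 1 from rfl]

theorem setIntegral_fderiv_mul_det_fderiv {G : E → E} (hG : ContDiff ℝ 1 G) {R : ℝ}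
    (hR : ∀ x, R ≤ ‖x‖ → G x = x) {ψ : E → ℝ} (hψ : ContDiff ℝ 1 ψ)
    (hψR : ∀ x, R ≤ ‖x‖ → ψ x = 0) (a : E) :
    ∫ x in closedBall (0 : E) R, fderiv ℝ ψ (G x) a * (fderiv ℝ G x).det ∂μ = 0 := by
  have h1 := setIntegral_det_fderiv μ hG hR
  have h2 := setIntegral_det_fderiv μ (G := fun x => G x + ψ (G x) • a)
    (hG.add ((hψ.comp hG).smul contDiff_const)) (R := R)
    (fun x hx => by simp [hR x hx, hψR x hx])
  have h3 : ∀ x, (fderiv ℝ (fun x => G x + ψ (G x) • a) x).det =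
      (fderiv ℝ G x).det + fderiv ℝ ψ (G x) a * (fderiv ℝ G x).det := by
    intro x
    have hGx := (hG.differentiable one_ne_zero x).hasFDerivAt
    have hψx := (hψ.differentiable one_ne_zero (G x)).hasFDerivAt
    have hP : HasFDerivAt (fun y => y + ψ y • a)
        (ContinuousLinearMap.id ℝ E + (fderiv ℝ ψ (G x)).smulRight a) (G x) :=
      (hasFDerivAt_id _).add (hψx.smul_const a)
    have hc := hP.comp x hGx
    rw [show (fun x => G x + ψ (G x) • a) = (fun y => y + ψ y • a) ∘ G from rfl, hc.fderiv]
    have := LinearMap.transvection.det (fderiv ℝ ψ (G x) : E →ₗ[ℝ] ℝ) a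
    simp only [ContinuousLinearMap.det, ContinuousLinearMap.toLinearMap_comp, LinearMap.det_comp]
    rw [show ((ContinuousLinearMap.id ℝ E + (fderiv ℝ ψ (G x)).smulRight a : E →L[ℝ] E) : E →ₗ[ℝ] E)
      = LinearMap.transvection (fderiv ℝ ψ (G x) : E →ₗ[ℝ] ℝ) a from by
        ext y; simp [LinearMap.transvection], this]
    simp; ring
  simp_rw [h3] at h2
  have hi : ∀ {g : E → ℝ}, Continuous g → IntegrableOn g (closedBall 0 R) μ := fun hg =>
    hg.continuousOn.integrableOn_compact
        (isCompact_closedBall _ _)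
  have hdet : Continuous fun x => (fderiv ℝ G x).det :=
    hG.continuous_det_fderiv
  have hd : Continuous fun x => fderiv ℝ ψ (G x) a :=
    ((hψ.continuous_fderiv one_ne_zero).comp hG.continuous).clm_apply continuous_const
  rw [integral_add (hi hdet) (hi (g := fun x => fderiv ℝ ψ (G x) a * (fderiv ℝ G x).det)
    (hd.mul hdet)), h1] at h2
  linarith

theorem integral_comp_mul_det_fderiv [Nontrivial E] {G : E → E} (hG : ContDiff ℝ 1 G) {ρ : ℝ}
    (hρ : ∀ x, ρ ≤ ‖x‖ → G x = x) {φ : E → ℝ} (hφ : ContDiff ℝ 1 φ) (hφc : HasCompactSupport φ) :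
    ∫ x, φ (G x) * (fderiv ℝ G x).det ∂μ = ∫ x, φ x ∂μ := by
  obtain ⟨r, hr⟩ := hφc.isCompact.isBounded.subset_closedBall (0 : E)
  have hφr : ∀ x, r < ‖x‖ → φ x = 0 := fun x hx => image_eq_zero_of_notMem_tsupport fun h => by
    have := hr h
    simp at this; linarith
  obtain ⟨B, hB⟩ := ((isCompact_closedBall (0 : E) ρ).image hG.continuous).isBounded.subset_closedBall
    (0 : E)
  have hGB : ∀ x, ‖x‖ ≤ ρ → ‖G x‖ ≤ B := fun x hx => by
    have := hB (mem_image_of_mem G (by simpa using hx))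
    simpa using this
  obtain ⟨a, ha⟩ := NormedSpace.exists_lt_norm ℝ E (max B ρ + r)
  have hdet : Continuous fun x => (fderiv ℝ G x).det := hG.continuous_det_fderiv
  set R := max ρ (r + ‖a‖ + 1) with hRdef
  have hRρ : ∀ x, R ≤ ‖x‖ → G x = x := fun x hx => hρ x ((le_max_left _ _).trans hx)
  have hout : ∀ s ∈ Icc (0 : ℝ) 1, ∀ x, R ≤ ‖x‖ → φ (x - s • a) = 0 := by
    intro s hs x hx
    apply hφr
    have h1 := norm_sub_norm_le x (s • a)
    rw [norm_smul, Real.norm_of_nonneg hs.1] at h1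
    have h2 := (le_max_right ρ (r + ‖a‖ + 1)).trans hx
    nlinarith [norm_nonneg a, hs.2]
  let h : ℝ → ℝ := fun s => ∫ x in closedBall (0 : E) R, φ (G x - s • a) * (fderiv ℝ G x).det ∂μ
  obtain ⟨C, hC⟩ := (hφc.fderiv (𝕜 := ℝ)).exists_bound_of_continuous (hφ.continuous_fderiv one_ne_zero)
  have hder : ∀ s ∈ Icc (0 : ℝ) 1, HasDerivAt h 0 s := by
    intro s hs
    have hcont : ∀ s : ℝ, Continuous fun x => φ (G x - s • a) * (fderiv ℝ G x).det := fun s =>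
      (hφ.continuous.comp (hG.continuous.sub continuous_const)).mul hdet
    have hcont' : ∀ s : ℝ, Continuous fun x =>
        fderiv ℝ φ (G x - s • a) (-a) * (fderiv ℝ G x).det := fun s =>
      (((hφ.continuous_fderiv one_ne_zero).comp (hG.continuous.sub continuous_const)).clm_apply
        continuous_const).mul hdet
    have hi : ∀ {g : E → ℝ}, Continuous g → IntegrableOn g (closedBall 0 R) μ := fun hg =>
      hg.continuousOn.integrableOn_compact
        (isCompact_closedBall _ _)
    have := (hasDerivAt_integral_of_dominated_loc_of_deriv_le (μ := μ.restrict (closedBall 0 R))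
      (F := fun s x => φ (G x - s • a) * (fderiv ℝ G x).det)
      (F' := fun s x => fderiv ℝ φ (G x - s • a) (-a) * (fderiv ℝ G x).det) (s := univ) (x₀ := s)
      (bound := fun x => C * ‖a‖ * ‖(fderiv ℝ G x).det‖) univ_mem
      (Eventually.of_forall fun s => (hcont s).aestronglyMeasurable) (hi (hcont s))
      (hcont' s).aestronglyMeasurable
      (Eventually.of_forall fun x s _ => by
        rw [norm_mul]
        gcongr
        refine ((fderiv ℝ φ (G x - s • a)).le_opNorm _).trans ?_
        rw [norm_neg]
        gcongr
        exact hC _) (hi (continuous_const.mul hdet.norm))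
      (Eventually.of_forall fun x s _ => by
        refine HasDerivAt.mul_const ?_ _
        have h1 : HasDerivAt (fun s : ℝ => G x - s • a) (-a) s := by
          simpa using ((hasDerivAt_id s).smul_const a).const_sub (G x)
        exact ((hφ.differentiable one_ne_zero _).hasFDerivAt).comp_hasDerivAt s h1)).2
    convert! this using 1
    have h0 := setIntegral_fderiv_mul_det_fderiv μ hG hRρ (ψ := fun y => φ (y - s • a))
      (hφ.comp (contDiff_id.sub contDiff_const)) (hout s hs) (-a)
    simpa only [fderiv_comp_sub] using h0.symm
  have hconst : h 1 = h 0 := constant_of_has_deriv_right_zero (a := 0) (b := 1)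
    (fun s hs => (hder s hs).continuousAt.continuousWithinAt)
    (fun s hs => (hder s (Ico_subset_Icc_self hs)).hasDerivWithinAt) 1 (by simp)
  have hset : ∀ s ∈ Icc (0 : ℝ) 1, h s = ∫ x, φ (G x - s • a) * (fderiv ℝ G x).det ∂μ := by
    intro s hs
    refine setIntegral_eq_integral_of_forall_compl_eq_zero fun x hx => ?_
    have hx' : R ≤ ‖x‖ := by
      simp only [mem_closedBall, dist_zero_right, not_le] at hx; exact hx.le
    rw [hRρ x hx', hout s hs x hx', zero_mul]
  have h0 := hset 0 (by simp)
  have h1 := hset 1 (by simp)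
  simp only [zero_smul, sub_zero, one_smul] at h0 h1
  rw [← h0, ← hconst, h1, ← integral_sub_right_eq_self φ a]
  congr 1
  ext x
  by_cases hx : ‖x‖ ≤ ρ
  · have h2 := norm_sub_norm_le a (G x)
    have h3 := norm_sub_norm_le a x
    rw [norm_sub_rev] at h2 h3
    rw [hφr (G x - a) (by linarith [hGB x hx, le_max_left B ρ]),
      hφr (x - a) (by linarith [le_max_right B ρ]), zero_mul]
  · rw [fderiv_eq_one_of_norm_lt hρ (not_le.1 hx), hρ x (not_le.1 hx).le]
    simp [ContinuousLinearMap.det]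

end Degree

/-- The algebraic count of the zeros of a map which is the identity near infinity is one. -/
theorem exists_finset_zeros_sum_sign_det_fderiv {E : Type*} [NormedAddCommGroup E]
    [NormedSpace ℝ E] [FiniteDimensional ℝ E] [Nontrivial E] {G : E → E} (hG : ContDiff ℝ 1 G)
    {ρ : ℝ} (hρ : ∀ x, ρ ≤ ‖x‖ → G x = x) (hreg : ∀ x, G x = 0 → (fderiv ℝ G x).det ≠ 0) :
    ∃ Z : Finset E, (∀ x, x ∈ Z ↔ G x = 0) ∧
      ∑ z ∈ Z, (SignType.sign (fderiv ℝ G z).det : ℤ) = 1 := by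
  classical
  borelize E
  let μ : Measure E := Measure.addHaar
  set R := max ρ 1
  have hR : ∀ x, R ≤ ‖x‖ → G x ≠ 0 := fun x hx h0 => by
    rw [hρ x ((le_max_left _ _).trans hx)] at h0
    have := (le_max_right ρ 1).trans hx
    rw [h0, norm_zero] at this; linarith
  have hbd : {x | G x = 0} ⊆ closedBall 0 R := fun x hx => by
    by_contra h
    simp only [mem_closedBall, dist_zero_right, not_le] at h
    exact hR x h.le hx
  have hcpt : IsCompact {x | G x = 0} := (isCompact_closedBall (0 : E) R).of_isClosed_subset
    (isClosed_eq hG.continuous continuous_const) hbd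
  choose! U hUo hzU hUinj hUnhds hUsign using
    fun z (hz : G z = 0) => hG.exists_isOpen_injOn_det_fderiv (hreg z hz)
  obtain ⟨t, htz, ht⟩ := hcpt.elim_nhds_subcover U fun z hz => (hUo z hz).mem_nhds (hzU z hz)
  have htmem : ∀ x, x ∈ t ↔ G x = 0 := fun x => ⟨htz x, fun hx => by
    obtain ⟨z, hz, hxz⟩ := mem_iUnion₂.1 (ht hx)
    rwa [hUinj z (htz z hz) hxz (hzU z (htz z hz)) ((show G x = 0 from hx).trans (htz z hz).symm)]⟩
  refine ⟨t, htmem, ?_⟩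
  obtain ⟨V, hV, hVd⟩ := t.finite_toSet.t2_separation
  let W : E → Set E := fun z => U z ∩ V z
  have hWo : ∀ z ∈ t, IsOpen (W z) := fun z hz => (hUo z (htz z hz)).inter (hV z).2
  have hzW : ∀ z ∈ t, z ∈ W z := fun z hz => ⟨hzU z (htz z hz), (hV z).1⟩
  have hWd : (t : Set E).PairwiseDisjoint W := fun a ha b hb hab =>
    (hVd ha hb hab).mono inter_subset_right inter_subset_right
  have hN1 : ∀ z ∈ t, G '' W z ∈ 𝓝 0 := fun z hz => by
    have := hUnhds z (htz z hz) _ (hWo z hz) (hzW z hz)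
    rwa [htz z hz] at this
  have hK : IsCompact (G '' (closedBall 0 R \ ⋃ z ∈ t, W z)) :=
    ((isCompact_closedBall (0 : E) R).diff (isOpen_biUnion hWo)).image hG.continuous
  have hN2 : (G '' (closedBall 0 R \ ⋃ z ∈ t, W z))ᶜ ∈ 𝓝 (0 : E) := by
    refine hK.isClosed.isOpen_compl.mem_nhds ?_
    rintro ⟨x, hx, hx0⟩
    exact hx.2 (mem_iUnion₂.2 ⟨x, (htmem x).2 hx0, hzW x ((htmem x).2 hx0)⟩)
  have hN3 : (⋂ z ∈ t, G '' W z) ∩ (G '' (closedBall 0 R \ ⋃ z ∈ t, W z))ᶜ ∩ ball 0 R ∈ 𝓝 (0 : E) :=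
    inter_mem (inter_mem ((Filter.biInter_finset_mem t).2 hN1) hN2)
      (ball_mem_nhds _ (lt_of_lt_of_le one_pos (le_max_right _ _)))
  obtain ⟨ε, hε, hball⟩ := Metric.mem_nhds_iff.1 hN3
  let φ : ContDiffBump (0 : E) := ⟨ε / 2, ε, by positivity, by linarith⟩
  have hsupp : ∀ y, φ y ≠ 0 → y ∈ ball (0 : E) ε := fun y hy => by
    rw [← show φ.rOut = ε from rfl, ← φ.support_eq]; exact hy
  have hsumint := integral_comp_mul_det_fderiv μ hG hρ (φ := φ) φ.contDiff φ.hasCompactSupport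
  have hpos : 0 < ∫ x, φ x ∂μ := φ.integral_pos
  have hsub : ∀ x, φ (G x) ≠ 0 → x ∈ ⋃ z ∈ t, W z := fun x hx => by
    have h1 := hball (hsupp _ hx)
    by_contra h
    refine h1.1.2 ⟨x, ⟨?_, h⟩, rfl⟩
    by_contra hxR
    simp only [mem_closedBall, dist_zero_right, not_le] at hxR
    have h2 := h1.2
    rw [hρ x ((le_max_left _ _).trans hxR.le)] at h2
    simp only [mem_ball, dist_zero_right] at h2
    linarith
  have hcontI : Continuous fun x => φ (G x) * (fderiv ℝ G x).det :=
    (φ.continuous.comp hG.continuous).mul hG.continuous_det_fderiv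
  have hIon : ∀ z ∈ t, IntegrableOn (fun x => φ (G x) * (fderiv ℝ G x).det) (W z) μ := by
    intro z _
    refine (hcontI.integrable_of_hasCompactSupport ?_).integrableOn
    refine HasCompactSupport.intro (isCompact_closedBall (0 : E) R) fun x hx => ?_
    simp only [mem_closedBall, dist_zero_right, not_le] at hx
    rw [hρ x ((le_max_left _ _).trans hx.le)]
    by_contra h
    have := (hball (hsupp x (left_ne_zero_of_mul h))).2
    simp only [mem_ball, dist_zero_right] at this
    linarith
  rw [← setIntegral_eq_integral_of_forall_compl_eq_zero (s := ⋃ z ∈ t, W z) (fun x hx => by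
    by_contra h
    exact hx (hsub x (left_ne_zero_of_mul h))),
    integral_biUnion_finset t (fun z hz => (hWo z hz).measurableSet) hWd hIon] at hsumint
  have hpiece : ∀ z ∈ t, ∫ x in W z, φ (G x) * (fderiv ℝ G x).det ∂μ =
      ((SignType.sign (fderiv ℝ G z).det : ℤ) : ℝ) * ∫ x, φ x ∂μ := by
    intro z hz
    have h1 : ∀ x ∈ W z, φ (G x) * (fderiv ℝ G x).det =
        ((SignType.sign (fderiv ℝ G z).det : ℤ) : ℝ) * (|(fderiv ℝ G x).det| • φ (G x)) := by
      intro x hx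
      rw [← hUsign z (htz z hz) x hx.1]
      have := sign_mul_abs (fderiv ℝ G x).det
      rw [smul_eq_mul, ← mul_assoc]
      rw [SignType.intCast_cast] 
      rw [this, mul_comm]
    rw [setIntegral_congr_fun (hWo z hz).measurableSet h1, integral_const_mul,
      ← integral_image_eq_integral_abs_det_fderiv_smul μ (hWo z hz).measurableSet
        (fun x _ => (hG.differentiable one_ne_zero x).hasFDerivAt.hasFDerivWithinAt)
        ((hUinj z (htz z hz)).mono inter_subset_left),
      setIntegral_eq_integral_of_forall_compl_eq_zero fun y hy => ?_]
    by_contra h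
    exact hy (mem_iInter₂.1 (hball (hsupp y h)).1.1 z hz)
  rw [Finset.sum_congr rfl hpiece, ← Finset.sum_mul] at hsumint
  have := mul_right_cancel₀ hpos.ne' (hsumint.trans (one_mul _).symm)
  exact_mod_cast this

/-- Smoothing a continuous map away from a region containing its zeros, without creating zeros. -/
theorem exists_contDiff_eqOn_of_ne_zero {E : Type*} [NormedAddCommGroup E] [NormedSpace ℝ E]
    [FiniteDimensional ℝ E] {G : E → E} (hG : Continuous G) {O C U : Set E} (hO : IsOpen O)
    (hC : IsClosed C) (hU : IsOpen U) (hOC : O ⊆ C) (hCU : C ⊆ U) (hGU : ContDiffOn ℝ 1 G U)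
    (h0 : ∀ x, G x = 0 → x ∈ O) :
    ∃ g : E → E, ContDiff ℝ 1 g ∧ EqOn g G C ∧ ∀ x, g x = 0 → x ∈ O := by
  rcases Oᶜ.eq_empty_or_nonempty with hne | hne
  · rw [compl_empty_iff] at hne
    have hUu : U = univ := univ_subset_iff.1 (hne ▸ hOC.trans hCU)
    exact ⟨G, contDiffOn_univ.1 (hUu ▸ hGU), fun _ _ => rfl, h0⟩
  obtain ⟨g, hg, hd, heq, -⟩ := hG.exists_contDiff_approx_and_eqOn 1
    (ε := fun x => ‖G x‖ + infDist x Oᶜ) (by fun_prop) (fun x => by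
      by_cases hx : G x = 0
      · have := (hO.isClosed_compl.notMem_iff_infDist_pos hne).1 (fun h => h (h0 x hx))
        positivity
      · have := norm_pos_iff.2 hx
        have := infDist_nonneg (x := x) (s := Oᶜ)
        positivity) hC (hU.mem_nhdsSet.2 hCU) hGU
  refine ⟨g, hg, heq, fun x hx => ?_⟩
  by_contra hxO
  have := hd x
  rw [hx, dist_zero_left, infDist_zero_of_mem hxO, add_zero] at this
  exact lt_irrefl _ this

/-- Punctured Euclidean space. -/
abbrev PuncturedEu (n : ℕ) : Type := {x : Eu n // x ≠ 0}

theorem Sph.norm_coe {n : ℕ} (p : Sph n) : ‖(p : Eu n)‖ = 1 := by simp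

theorem Sph.coe_ne_zero {n : ℕ} (p : Sph n) : (p : Eu n) ≠ 0 := fun h => by
  simpa [h] using Sph.norm_coe p

/-- The map of `S^n` to punctured space given by a nonvanishing map. -/
def Sph.toPunctured {n : ℕ} (f : Eu n → Eu n) (hf : Continuous fun p : Sph n => f p)
    (h0 : ∀ p : Sph n, f p ≠ 0) : C(Sph n, PuncturedEu n) :=
  ⟨fun p => ⟨f p, h0 p⟩, hf.subtype_mk _⟩

/-- The inclusion of the sphere in punctured space. -/
def Sph.incl (n : ℕ) : C(Sph n, PuncturedEu n) :=
  ⟨fun p => ⟨p, Sph.coe_ne_zero p⟩, by fun_prop⟩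

/-- Radial projection to the sphere, with a junk value at the origin. -/
def toSph {n : ℕ} (x : Eu n) : Sph n :=
  if h : x = 0 then ⟨EuclideanSpace.single 0 1, by simp⟩ else
    ⟨‖x‖⁻¹ • x, by simp [norm_smul, norm_ne_zero_iff.2 h]⟩

theorem coe_toSph {n : ℕ} {x : Eu n} (hx : x ≠ 0) : (toSph x : Eu n) = ‖x‖⁻¹ • x := by
  simp [toSph, hx]

theorem toSph_coe {n : ℕ} (p : Sph n) : toSph (p : Eu n) = p := by
  ext1
  rw [coe_toSph (Sph.coe_ne_zero p)]; simp

theorem norm_smul_toSph {n : ℕ} {x : Eu n} (hx : x ≠ 0) : ‖x‖ • (toSph x : Eu n) = x := by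
  rw [coe_toSph hx, smul_smul, mul_inv_cancel₀ (norm_ne_zero_iff.2 hx), one_smul]

theorem continuousOn_toSph {n : ℕ} : ContinuousOn (toSph (n := n)) {0}ᶜ := by
  rw [Topology.IsInducing.subtypeVal.continuousOn_iff]
  refine ContinuousOn.congr (f := fun x : Eu n => ‖x‖⁻¹ • x) ?_ fun x hx => coe_toSph hx
  exact (continuous_norm.continuousOn.inv₀ fun x hx => norm_ne_zero_iff.2 hx).smul continuousOn_id

theorem PuncturedEu.homotopic_of_segment {X : Type*} [TopologicalSpace X] {n : ℕ}
    (a b : C(X, PuncturedEu n))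
    (h : ∀ x, ∀ t ∈ Icc (0 : ℝ) 1, (1 - t) • (a x : Eu n) + t • (b x : Eu n) ≠ 0) :
    a.Homotopic b :=
  ⟨{ toFun := fun q => ⟨(1 - (q.1 : ℝ)) • (a q.2 : Eu n) + (q.1 : ℝ) • (b q.2 : Eu n),
        h q.2 q.1 q.1.2⟩
     continuous_toFun := by fun_prop
     map_zero_left := fun x => by ext1; simp
     map_one_left := fun x => by ext1; simp }⟩

theorem PuncturedEu.homotopic_of_norm_sub_lt {X : Type*} [TopologicalSpace X] {n : ℕ}
    (a b : C(X, PuncturedEu n)) (h : ∀ x, ‖(b x : Eu n) - a x‖ < ‖(a x : Eu n)‖) :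
    a.Homotopic b := by
  refine homotopic_of_segment a b fun x t ht h0 => ?_
  have h1 : (a x : Eu n) = -(t • ((b x : Eu n) - a x)) := by
    rw [eq_neg_iff_add_eq_zero]; refine Eq.trans ?_ h0; module
  have h2 := congrArg norm h1
  rw [norm_neg, norm_smul, Real.norm_of_nonneg ht.1] at h2
  nlinarith [h x, ht.2, norm_nonneg ((b x : Eu n) - a x)]

/-- Radial projection of punctured space on the sphere as a continuous map. -/
def PuncturedEu.toSph (n : ℕ) : C(PuncturedEu n, Sph n) :=
  ⟨fun x => _root_.toSph x.1, continuousOn_toSph.comp_continuous continuous_subtype_val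
    fun x => x.2⟩

theorem PuncturedEu.toSph_comp_incl (n : ℕ) :
    (PuncturedEu.toSph n).comp (Sph.incl n) = ContinuousMap.id _ := by
  ext1 p; exact toSph_coe p

theorem Sph.homotopic_iff {X : Type*} [TopologicalSpace X] {n : ℕ} (f g : C(X, Sph n)) :
    f.Homotopic g ↔ ((Sph.incl n).comp f).Homotopic ((Sph.incl n).comp g) := by
  refine ⟨fun h => (ContinuousMap.Homotopic.refl _).comp h, fun h => ?_⟩
  have := (ContinuousMap.Homotopic.refl (PuncturedEu.toSph n)).comp h
  simpa only [← ContinuousMap.comp_assoc, PuncturedEu.toSph_comp_incl, ContinuousMap.id_comp]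
    using this

theorem hasFDerivAt_inv_norm_smul {n : ℕ} {x : Eu n} (hx : x ≠ 0) :
    DifferentiableAt ℝ (fun y : Eu n => ‖y‖⁻¹ • y) x := by
  have : DifferentiableAt ℝ (fun y : Eu n => ‖y‖) x :=
    (contDiffAt_norm ℝ hx).differentiableAt one_ne_zero
  exact (this.inv (norm_ne_zero_iff.2 hx)).smul differentiableAt_id

theorem det_fderiv_neg_of_refl {n : ℕ} {S : Eu n → Eu n} {x : Eu n} (hx : x ≠ 0)
    (hS : DifferentiableAt ℝ S x) (hS' : DifferentiableAt ℝ S (-x))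
    (hsym : ∀ᶠ y in 𝓝 x, S (-y) = Refl (‖y‖⁻¹ • y) (S y)) (h0 : S x = 0) :
    (fderiv ℝ S (-x)).det = (-1) ^ n * (fderiv ℝ S x).det := by
  set p := ‖x‖⁻¹ • x with hp
  have hp1 : ‖p‖ = 1 := by
    rw [hp, norm_smul, norm_inv, norm_norm, inv_mul_cancel₀ (norm_ne_zero_iff.2 hx)]
  have hN := (hasFDerivAt_inv_norm_smul hx).hasFDerivAt
  have hD := hS.hasFDerivAt
  have h1 := hD.sub (((hN.inner ℝ hD).const_mul 2).smul hN)
  have h2 : HasFDerivAt (fun y => S (-y)) ((fderiv ℝ S (-x)).comp (-ContinuousLinearMap.id ℝ _)) x :=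
    hS'.hasFDerivAt.comp x (hasFDerivAt_id x).neg
  have h3 := (h2.congr_of_eventuallyEq (f₁ := fun y => Refl (‖y‖⁻¹ • y) (S y))
    (by filter_upwards [hsym] with y hy using hy.symm)).unique h1
  have h4 : (fderiv ℝ S (-x) : Eu n →ₗ[ℝ] Eu n) =
      (-1 : ℝ) • (LinearMap.transvection ((-2 : ℝ) • (innerₛₗ ℝ p)) p ∘ₗ
        (fderiv ℝ S x : Eu n →ₗ[ℝ] Eu n)) := by
    ext1 v
    have := congrArg (fun A => A (-v)) h3
    simp only [ContinuousLinearMap.coe_comp, Function.comp_apply] at this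
    simp [h0, LinearMap.transvection, ← hp] at this ⊢
    rw [this]
    module
  rw [ContinuousLinearMap.det, h4, LinearMap.det_smul, LinearMap.det_comp,
    LinearMap.transvection.det]
  simp [hp1, pow_succ, ContinuousLinearMap.det]
  ring

/-- An auxiliary map on a shell, whose zeros record the points where `F` is radial. -/
def shellMap {n : ℕ} (F : Eu n → Eu n) (x : Eu n) : Eu n :=
  F (‖x‖⁻¹ • x) + (‖x‖ - 3) • (‖x‖⁻¹ • x)

theorem shellMap_neg {n : ℕ} {F : Eu n → Eu n} (hF : ∀ p : Sph n, F (-p) = Refl (p : Eu n) (F p))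
    {x : Eu n} (hx : x ≠ 0) : shellMap F (-x) = Refl (‖x‖⁻¹ • x) (shellMap F x) := by
  have h := hF (toSph x)
  rw [coe_toSph hx] at h
  have hpp : ⟪‖x‖⁻¹ • x, ‖x‖⁻¹ • x⟫ = (1 : ℝ) := by
    rw [real_inner_self_eq_norm_sq, norm_smul, norm_inv, norm_norm,
      inv_mul_cancel₀ (norm_ne_zero_iff.2 hx), one_pow]
  simp only [shellMap, norm_neg, smul_neg, h]
  unfold Refl
  rw [inner_add_right, inner_smul_right (r := ‖x‖ - 3), hpp]
  module

theorem contDiffOn_shellMap {n : ℕ} {F : Eu n → Eu n} (hF : ContDiff ℝ 1 F) :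
    ContDiffOn ℝ 1 (shellMap F) {0}ᶜ := by
  have h1 : ContDiffOn ℝ 1 (fun x : Eu n => ‖x‖) {0}ᶜ := fun x hx =>
    (contDiffAt_norm ℝ hx).contDiffWithinAt
  have h2 : ContDiffOn ℝ 1 (fun x : Eu n => ‖x‖⁻¹ • x) {0}ᶜ :=
    (h1.inv fun x hx => norm_ne_zero_iff.2 hx).smul contDiffOn_id
  exact (hF.comp_contDiffOn h2).add ((h1.sub contDiffOn_const).smul h2)

theorem sum_sign_shell {n : ℕ} {F g : Eu n → Eu n}
    (hF : ContDiff ℝ 1 F) (hsym : ∀ p : Sph n, F (-p) = Refl (p : Eu n) (F p))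
    (hreg : ∀ x, 3 < ‖x‖ → ‖x‖ < 8 → shellMap F x = 0 → (fderiv ℝ (shellMap F) x).det ≠ 0)
    (Z : Finset (Eu n)) (hZ : ∀ x, x ∈ Z ↔ 3 < ‖x‖ ∧ ‖x‖ < 8 ∧ shellMap F x = 0)
    (hg : ∀ x ∈ Z, g =ᶠ[𝓝 x] shellMap F) :
    Even (∑ z ∈ Z, (SignType.sign (fderiv ℝ g z).det : ℤ)) ∧
      (Odd n → ∑ z ∈ Z, (SignType.sign (fderiv ℝ g z).det : ℤ) = 0) := by
  have hne : ∀ x ∈ Z, x ≠ 0 := fun x hx h => by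
    have := ((hZ x).1 hx).1
    rw [h, norm_zero] at this; linarith
  have hneg : ∀ x ∈ Z, -x ∈ Z := fun x hx => by
    have h := (hZ x).1 hx
    refine (hZ _).2 ⟨by simpa using h.1, by simpa using h.2.1, ?_⟩
    rw [shellMap_neg hsym (hne x hx), h.2.2]; simp [Refl]
  have hdiff : ∀ x ∈ Z, DifferentiableAt ℝ (shellMap F) x := fun x hx =>
    ((contDiffOn_shellMap hF).contDiffAt (isOpen_compl_singleton.mem_nhds (hne x hx))).differentiableAt
      one_ne_zero
  have hdet : ∀ x ∈ Z, (fderiv ℝ g (-x)).det = (-1) ^ n * (fderiv ℝ g x).det := fun x hx => by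
    rw [(hg x hx).fderiv_eq, (hg _ (hneg x hx)).fderiv_eq]
    refine det_fderiv_neg_of_refl (hne x hx) (hdiff x hx) (hdiff _ (hneg x hx)) ?_
      ((hZ x).1 hx).2.2
    filter_upwards [isOpen_compl_singleton.mem_nhds (hne x hx)] with y hy
    exact shellMap_neg hsym hy
  have hfix : ∀ x ∈ Z, -x ≠ x := fun x hx h => hne x hx (by
    have h2 : (2 : ℝ) • x = 0 := by
      rw [two_smul]; nth_rewrite 1 [← h]; exact neg_add_cancel x
    exact (smul_eq_zero.1 h2).resolve_left two_ne_zero)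
  refine ⟨?_, fun hn => ?_⟩
  · have h2 : ((∑ z ∈ Z, (SignType.sign (fderiv ℝ g z).det : ℤ) : ℤ) : ZMod 2) = 0 := by
      rw [Int.cast_sum]
      refine Finset.sum_involution (fun x _ => -x) (fun x hx => ?_) (fun x hx _ => hfix x hx)
        hneg (fun x _ => neg_neg x)
      have h0 : (fderiv ℝ g x).det ≠ 0 := by
        rw [(hg x hx).fderiv_eq]
        have := (hZ x).1 hx
        exact hreg x this.1 this.2.1 this.2.2
      rw [hdet x hx]
      rcases lt_or_gt_of_ne h0 with h | h <;> rcases neg_one_pow_eq_or ℝ n with hn | hn <;>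
        simp [hn, h] <;> decide
    exact even_iff_two_dvd.2 (by exact_mod_cast (ZMod.intCast_zmod_eq_zero_iff_dvd _ 2).1 h2)
  · refine Finset.sum_involution (fun x _ => -x) (fun x hx => ?_) (fun x hx _ => hfix x hx)
      hneg (fun x _ => neg_neg x)
    rw [hdet x hx, hn.neg_one_pow]
    simp [Left.sign_neg]

/-- The algebraic number of zeros in the unit ball of an extension of a map homotopic to a
reflection symmetric one. -/
theorem sum_sign_of_homotopic {n : ℕ} {F L : Eu n → Eu n}
    (hF : ContDiff ℝ 1 F) (hsym : ∀ p : Sph n, F (-p) = Refl (p : Eu n) (F p))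
    (hreg : ∀ x, 3 < ‖x‖ → ‖x‖ < 8 → shellMap F x = 0 → (fderiv ℝ (shellMap F) x).det ≠ 0)
    (hF1 : ∀ p : Sph n, 1 / 2 ≤ ‖F p‖) (hF2 : ∀ p : Sph n, ‖F p‖ ≤ 2)
    (hL : ContDiff ℝ 1 L) {r : ℝ} (hr : r < 1) (hLr : ∀ x, ‖x‖ ≤ 1 → L x = 0 → ‖x‖ < r)
    (hLreg : ∀ x, ‖x‖ ≤ 1 → L x = 0 → (fderiv ℝ L x).det ≠ 0)
    {l f : C(Sph n, PuncturedEu n)} (hl : ∀ p : Sph n, (l p : Eu n) = L p)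
    (hf : ∀ p : Sph n, (f p : Eu n) = F p) (hlf : l.Homotopic f) :
    ∃ Z : Finset (Eu n), (∀ x, x ∈ Z ↔ ‖x‖ ≤ 1 ∧ L x = 0) ∧
      Odd (∑ z ∈ Z, (SignType.sign (fderiv ℝ L z).det : ℤ)) ∧
      (Odd n → ∑ z ∈ Z, (SignType.sign (fderiv ℝ L z).det : ℤ) = 1) := by
  classical
  obtain ⟨H⟩ := hlf
  let χ : ℝ → ℝ := fun s => max 0 (min 1 (s - 8))
  let lam : ℝ → ℝ := fun s => max (s - 3) 0 + 3 * χ s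
  have hχc : Continuous χ := by fun_prop
  have hlamc : Continuous lam := by fun_prop
  have hχ0 : ∀ s ≤ 8, χ s = 0 := fun s hs => by
    simp only [χ]; rw [max_eq_left]; exact (min_le_right _ _).trans (by linarith)
  have hχ1 : ∀ s, 9 ≤ s → χ s = 1 := fun s hs => by
    simp only [χ]; rw [min_eq_left (by linarith)]; simp
  have hχm : ∀ s, 0 ≤ χ s ∧ χ s ≤ 1 := fun s =>
    ⟨le_max_left _ _, max_le zero_le_one (min_le_left _ _)⟩
  have hlam0 : ∀ s ≤ 3, lam s = 0 := fun s hs => by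
    simp only [lam]; rw [hχ0 s (by linarith), max_eq_right (by linarith)]; simp
  have hlam1 : ∀ s, 3 ≤ s → s ≤ 8 → lam s = s - 3 := fun s hs hs' => by
    simp only [lam]; rw [hχ0 s hs', max_eq_left (by linarith)]; simp
  have hlam2 : ∀ s, 9 ≤ s → lam s = s := fun s hs => by
    simp only [lam]; rw [hχ1 s hs, max_eq_left (by linarith)]; ring
  have hlam3 : ∀ s, 3 ≤ s → s - 3 ≤ lam s := fun s hs => by
    simp only [lam]; rw [max_eq_left (by linarith)]; linarith [(hχm s).1]
  let K : Eu n → Eu n := fun x => H (projIcc 0 1 zero_le_one (‖x‖ - 1), toSph x)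
  have hK1 : ∀ x, ‖x‖ = 1 → K x = L x := fun x hx => by
    have : toSph x = ⟨x, by simpa using hx⟩ := toSph_coe ⟨x, by simpa using hx⟩
    simp only [K]
    rw [this, projIcc_of_le_left _ (by rw [hx, sub_self])]
    change ((H (0, _) : PuncturedEu n) : Eu n) = _
    rw [H.apply_zero, hl]
  have hK2 : ∀ x, 2 ≤ ‖x‖ → K x = F (toSph x) := fun x hx => by
    simp only [K]
    rw [projIcc_of_right_le _ (by linarith)]
    change ((H (1, _) : PuncturedEu n) : Eu n) = _
    rw [H.apply_one, hf]
  let Out : Eu n → Eu n := fun x => (1 - χ ‖x‖) • K x + lam ‖x‖ • (toSph x : Eu n)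
  let G : Eu n → Eu n := fun x => if ‖x‖ ≤ 1 then L x else Out x
  have htoc : ContinuousOn (toSph (n := n)) {x | 1 ≤ ‖x‖} := continuousOn_toSph.mono fun x hx h0 => by
    have h1 : (1 : ℝ) ≤ ‖x‖ := hx
    rw [show x = 0 from h0, norm_zero] at h1; linarith
  have hKc : ContinuousOn K {x | 1 ≤ ‖x‖} := by
    refine continuous_subtype_val.comp_continuousOn (H.continuous.comp_continuousOn ?_)
    exact (continuous_projIcc.comp (continuous_norm.sub continuous_const)).continuousOn.prodMk htoc
  have hOc : ContinuousOn Out {x | 1 ≤ ‖x‖} :=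
    ((continuous_const.sub (hχc.comp continuous_norm)).continuousOn.smul hKc).add
      ((hlamc.comp continuous_norm).continuousOn.smul (continuous_subtype_val.comp_continuousOn htoc))
  have hGc : Continuous G := continuous_if_le continuous_norm continuous_const
    hL.continuous.continuousOn hOc fun x hx => by
      simp only [Out]
      rw [hχ0 _ (by linarith), hlam0 _ (by linarith), hK1 x hx]; simp
  have hne0 : ∀ x : Eu n, 1 < ‖x‖ → x ≠ 0 := fun x hx h => by
    rw [h, norm_zero] at hx; linarith
  have hGin : ∀ x, ‖x‖ < 1 → G x = L x := fun x hx => if_pos hx.le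
  have hGsh : ∀ x, 3 < ‖x‖ → ‖x‖ < 8 → G x = shellMap F x := fun x hx hx' => by
    simp only [G, Out, shellMap]
    rw [if_neg (by linarith), hχ0 _ hx'.le, hlam1 _ hx.le hx'.le, hK2 x (by linarith),
      coe_toSph (hne0 x (by linarith))]
    simp
  have hGid : ∀ x, 9 ≤ ‖x‖ → G x = x := fun x hx => by
    simp only [G, Out]
    rw [if_neg (by linarith), hχ1 _ hx, hlam2 _ hx, norm_smul_toSph (hne0 x (by linarith))]
    simp
  have hO1 : IsOpen {x : Eu n | ‖x‖ < r} := isOpen_lt continuous_norm continuous_const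
  have hoab : ∀ a b : ℝ, IsOpen {x : Eu n | a < ‖x‖ ∧ ‖x‖ < b} := fun a b =>
    (isOpen_lt continuous_const continuous_norm).inter (isOpen_lt continuous_norm continuous_const)
  obtain ⟨g, hg, hgG, hg0⟩ := exists_contDiff_eqOn_of_ne_zero hGc
    (O := {x | ‖x‖ < r} ∪ {x | 13 / 4 < ‖x‖ ∧ ‖x‖ < 7})
    (C := {x | ‖x‖ ≤ r} ∪ {x | 13 / 4 ≤ ‖x‖ ∧ ‖x‖ ≤ 7} ∪ {x | 10 ≤ ‖x‖})
    (U := {x | ‖x‖ < 1} ∪ {x | 3 < ‖x‖ ∧ ‖x‖ < 8} ∪ {x | 9 < ‖x‖})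
    (hO1.union (hoab _ _))
    (((isClosed_le continuous_norm continuous_const).union
      ((isClosed_le continuous_const continuous_norm).inter
        (isClosed_le continuous_norm continuous_const))).union
      (isClosed_le continuous_const continuous_norm))
    (((isOpen_lt continuous_norm continuous_const).union (hoab _ _)).union
      (isOpen_lt continuous_const continuous_norm))
    (by
      rintro x (hx | hx)
      · exact Or.inl (Or.inl (show ‖x‖ < r from hx).le)
      · exact Or.inl (Or.inr ⟨hx.1.le, hx.2.le⟩))
    (by
      rintro x ((hx | hx) | hx)
      · exact Or.inl (Or.inl (lt_of_le_of_lt hx hr))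
      · exact Or.inl (Or.inr ⟨by linarith [hx.1], by linarith [hx.2]⟩)
      · exact Or.inr (lt_of_lt_of_le (by norm_num : (9 : ℝ) < 10) hx))
    (by
      rintro x ((hx | hx) | hx)
      · refine ContDiffAt.contDiffWithinAt ?_
        refine hL.contDiffAt.congr_of_eventuallyEq ?_
        filter_upwards [(isOpen_lt continuous_norm continuous_const).mem_nhds hx] with y hy
        exact hGin y hy
      · refine ContDiffAt.contDiffWithinAt ?_
        refine ((contDiffOn_shellMap hF).contDiffAt (isOpen_compl_singleton.mem_nhds
          (hne0 x (by linarith [hx.1])))).congr_of_eventuallyEq ?_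
        filter_upwards [(hoab 3 8).mem_nhds hx] with y hy
        exact hGsh y hy.1 hy.2
      · refine ContDiffAt.contDiffWithinAt ?_
        refine contDiffAt_id.congr_of_eventuallyEq ?_
        filter_upwards [(isOpen_lt continuous_const continuous_norm).mem_nhds hx] with y hy
        exact hGid y (le_of_lt hy))
    (by
      intro x hx
      by_contra hxO
      simp only [mem_union, mem_ofPred_eq, not_or, not_lt, not_and] at hxO
      obtain ⟨hxr, hx1⟩ := hxO
      rcases le_or_gt ‖x‖ 1 with h1 | h1
      · simp only [G] at hx
        rw [if_pos h1] at hx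
        exact (hLr x h1 hx).not_ge hxr
      have hx0 := hne0 x h1
      have hno : ‖(toSph x : Eu n)‖ = 1 := Sph.norm_coe _
      simp only [G, Out] at hx
      rw [if_neg (by linarith)] at hx
      rcases le_or_gt ‖x‖ 3 with h3 | h3
      · rw [hχ0 _ (by linarith), hlam0 _ h3, zero_smul, add_zero, sub_zero, one_smul] at hx
        exact (H _).2 hx
      rw [hK2 x (by linarith)] at hx
      have h4 : (1 - χ ‖x‖) * ‖F (toSph x)‖ = lam ‖x‖ := by
        have h5 := congrArg norm (eq_neg_of_add_eq_zero_left hx)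
        rwa [norm_neg, norm_smul, norm_smul, hno, mul_one, Real.norm_of_nonneg
          (by linarith [(hχm ‖x‖).2]), Real.norm_of_nonneg (by linarith [hlam3 _ h3.le])] at h5
      have h6 := hF1 (toSph x)
      have h7 := hF2 (toSph x)
      rcases le_or_gt ‖x‖ (13 / 4) with h8 | h8
      · rw [hχ0 _ (by linarith), hlam1 _ h3.le (by linarith)] at h4
        linarith
      · have h9 := hx1 h8
        have := hlam3 _ h3.le
        nlinarith [(hχm ‖x‖).1, (hχm ‖x‖).2])
  have hgin : ∀ x, ‖x‖ < r → g =ᶠ[𝓝 x] L := fun x hx => by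
    filter_upwards [hO1.mem_nhds hx] with y hy
    rw [hgG (Or.inl (Or.inl (le_of_lt hy))), hGin y (lt_trans hy hr)]
  have hgsh : ∀ x, 13 / 4 < ‖x‖ → ‖x‖ < 7 → g =ᶠ[𝓝 x] shellMap F := fun x hx hx' => by
    filter_upwards [(hoab (13 / 4) 7).mem_nhds ⟨hx, hx'⟩] with y hy
    rw [hgG (Or.inl (Or.inr ⟨hy.1.le, hy.2.le⟩)), hGsh y (by linarith [hy.1]) (by linarith [hy.2])]
  obtain ⟨Z, hZ, hsum⟩ := exists_finset_zeros_sum_sign_det_fderiv hg (ρ := 10)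
    (fun x hx => by rw [hgG (Or.inr hx), hGid x (by linarith)]) (fun x hx => by
      rcases hg0 x hx with h | h
      · rw [(hgin x h).fderiv_eq]
        exact hLreg x (h.le.trans hr.le) ((hgin x h).eq_of_nhds.symm.trans hx)
      · rw [(hgsh x h.1 h.2).fderiv_eq]
        exact hreg x (by linarith [h.1]) (by linarith [h.2]) ((hgsh x h.1 h.2).eq_of_nhds.symm.trans hx))
  rw [← Finset.sum_filter_add_sum_filter_not Z (fun x => ‖x‖ < r)] at hsum
  have hZ1 : ∀ x, x ∈ Z.filter (fun x => ‖x‖ < r) ↔ ‖x‖ ≤ 1 ∧ L x = 0 := fun x => by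
    rw [Finset.mem_filter, hZ]
    constructor
    · rintro ⟨h1, h2⟩
      exact ⟨h2.le.trans hr.le, (hgin x h2).eq_of_nhds.symm.trans h1⟩
    · rintro ⟨h1, h2⟩
      have := hLr x h1 h2
      exact ⟨(hgin x this).eq_of_nhds.trans h2, this⟩
  have hZ2 : ∀ x ∈ Z.filter (fun x => ¬ ‖x‖ < r), 13 / 4 < ‖x‖ ∧ ‖x‖ < 7 := fun x hx => by
    rw [Finset.mem_filter, hZ] at hx
    exact (hg0 x hx.1).resolve_left hx.2
  have hZ3 : ∀ x, x ∈ Z.filter (fun x => ¬ ‖x‖ < r) ↔ 3 < ‖x‖ ∧ ‖x‖ < 8 ∧ shellMap F x = 0 := by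
    intro x
    constructor
    · intro hx
      have h := hZ2 x hx
      rw [Finset.mem_filter, hZ] at hx
      exact ⟨by linarith [h.1], by linarith [h.2], (hgsh x h.1 h.2).eq_of_nhds.symm.trans hx.1⟩
    · rintro ⟨h1, h2, h3⟩
      have hx0 := hne0 x (by linarith)
      have h4 : ‖F (toSph x)‖ = ‖x‖ - 3 := by
        simp only [shellMap] at h3
        rw [← coe_toSph hx0] at h3
        have h5 := congrArg norm (eq_neg_of_add_eq_zero_left h3)
        rwa [norm_neg, norm_smul, Sph.norm_coe, mul_one, Real.norm_of_nonneg (by linarith)] at h5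
      have h6 := hF1 (toSph x)
      have h7 := hF2 (toSph x)
      rw [Finset.mem_filter, hZ, (hgsh x (by linarith) (by linarith)).eq_of_nhds]
      exact ⟨h3, by linarith⟩
  obtain ⟨he, ho⟩ := sum_sign_shell (g := g) hF hsym hreg _ hZ3 fun x hx =>
    hgsh x (hZ2 x hx).1 (hZ2 x hx).2
  have hcongr : ∑ z ∈ Z.filter (fun x => ‖x‖ < r), (SignType.sign (fderiv ℝ g z).det : ℤ) =
      ∑ z ∈ Z.filter (fun x => ‖x‖ < r), (SignType.sign (fderiv ℝ L z).det : ℤ) :=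
    Finset.sum_congr rfl fun x hx => by rw [(hgin x (Finset.mem_filter.1 hx).2).fderiv_eq]
  rw [hcongr] at hsum
  refine ⟨_, hZ1, ?_, fun hn => ?_⟩
  · rw [eq_sub_of_add_eq hsum]
    exact odd_one.sub_even he
  · rw [ho hn, add_zero] at hsum
    exact hsum

theorem MeasureTheory.Measure.exists_mem_notMem_of_measure_zero {E : Type*} [TopologicalSpace E]
    [MeasurableSpace E] (μ : Measure E) [μ.IsOpenPosMeasure] {V s : Set E} (hV : IsOpen V)
    (hVne : V.Nonempty) (hs : μ s = 0) : ∃ w ∈ V, w ∉ s := by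
  by_contra! h
  exact (hV.measure_pos μ hVne).ne' (measure_mono_null h hs)

theorem MeasureTheory.addHaar_image_critical_eq_zero {E : Type*} [NormedAddCommGroup E]
    [NormedSpace ℝ E] [FiniteDimensional ℝ E] [MeasurableSpace E] [BorelSpace E] (μ : Measure E)
    [μ.IsAddHaarMeasure] {Ψ : E → E} {U : Set E} (hΨ : ∀ x ∈ U, DifferentiableAt ℝ Ψ x) :
    μ (Ψ '' {x ∈ U | (fderiv ℝ Ψ x).det = 0}) = 0 :=
  addHaar_image_eq_zero_of_det_fderivWithin_eq_zero μ
    (fun x hx => (hΨ x hx.1).hasFDerivAt.hasFDerivWithinAt) fun _ hx => hx.2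

theorem Sph.exists_contDiff_approx {n : ℕ} {f : Sph n → Eu n} (hf : Continuous f) {ε : ℝ}
    (hε : 0 < ε) : ∃ F : Eu n → Eu n, ContDiff ℝ 1 F ∧ ∀ p : Sph n, ‖F p - f p‖ < ε := by
  have := TietzeExtension.of_tvs ℝ (E := Eu n)
  obtain ⟨g, hg⟩ := ContinuousMap.exists_extension (X := Eu n)
    (isClosed_sphere (x := (0 : Eu n)) (ε := 1)).isClosedEmbedding_subtypeVal ⟨f, hf⟩
  obtain ⟨F, hF, hd, -⟩ := g.continuous.exists_contDiff_approx 1 (ε := fun _ => ε)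
    continuous_const (fun _ => hε)
  refine ⟨F, hF, fun p => ?_⟩
  have h1 := DFunLike.congr_fun hg p
  rw [← dist_eq_norm]
  have h2 := hd p
  rwa [show g p = f p from h1] at h2

theorem norm_Refl {n : ℕ} (p : Sph n) (x : Eu n) : ‖Refl (p : Eu n) x‖ = ‖x‖ := by
  have hp : ⟪(p : Eu n), p⟫ = (1 : ℝ) := by
    rw [real_inner_self_eq_norm_sq, Sph.norm_coe, one_pow]
  have h : ‖Refl (p : Eu n) x‖ ^ 2 = ‖x‖ ^ 2 := by
    rw [← real_inner_self_eq_norm_sq, ← real_inner_self_eq_norm_sq]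
    simp only [Refl, inner_sub_left, inner_sub_right, inner_smul_left, inner_smul_right, hp,
      real_inner_comm x (p : Eu n)]
    simp
    ring
  exact (sq_eq_sq₀ (norm_nonneg _) (norm_nonneg _)).1 h

theorem Refl_sub {n : ℕ} (p x y : Eu n) : Refl p (x - y) = Refl p x - Refl p y := by
  simp only [Refl, inner_sub_right]; module

theorem exists_regular_equivariant_approx {n : ℕ} (f : C(Sph n, Sph n))
    (hf : ∀ p : Sph n, (f (-p) : Eu n) = Refl (p : Eu n) (f p : Eu n)) :
    ∃ F : Eu n → Eu n, ContDiff ℝ 1 F ∧ (∀ p : Sph n, F (-p) = Refl (p : Eu n) (F p)) ∧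
      (∀ x, 3 < ‖x‖ → ‖x‖ < 8 → shellMap F x = 0 → (fderiv ℝ (shellMap F) x).det ≠ 0) ∧
      ∀ p : Sph n, ‖F p - f p‖ < 1 / 2 := by
  obtain ⟨g, hg, hgf⟩ := Sph.exists_contDiff_approx (f := fun p => (f p : Eu n))
    (by fun_prop) (ε := 1 / 8) (by norm_num)
  let h : Eu n → Eu n := fun x => (1 / 2 : ℝ) • (g x + (g (-x) - (2 * ⟪x, g (-x)⟫) • x))
  have hgn : ContDiff ℝ 1 fun x => g (-x) := hg.comp contDiff_neg
  have hh : ContDiff ℝ 1 h := by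
    have : ContDiff ℝ 1 fun x : Eu n => ⟪x, g (-x)⟫ := contDiff_id.inner ℝ hgn
    fun_prop
  have hpp : ∀ p : Sph n, ⟪(p : Eu n), p⟫ = (1 : ℝ) := fun p => by
    rw [real_inner_self_eq_norm_sq, Sph.norm_coe, one_pow]
  have hhs : ∀ p : Sph n, h (-p) = Refl (p : Eu n) (h p) := fun p => by
    simp only [h, Refl, neg_neg, inner_add_right, inner_sub_right, inner_smul_right, inner_neg_left,
      hpp, mul_one]
    module
  have hhf : ∀ p : Sph n, ‖h p - f p‖ < 1 / 8 := fun p => by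
    have h1 : h p - f p = (1 / 2 : ℝ) • ((g p - f p) + Refl (p : Eu n) (g (-p) - f (-p))) := by
      have h7 : Refl (p : Eu n) (f (-p)) = f p := by
        rw [hf p]
        simp only [Refl, inner_sub_right, inner_smul_right, hpp]
        module
      rw [Refl_sub, h7]
      simp only [h, Refl]
      module
    rw [h1, norm_smul]
    have h2 := norm_add_le ((g p - f p)) (Refl (p : Eu n) (g (-p) - f (-p)))
    rw [norm_Refl] at h2
    have h3 := hgf p
    have h4 := hgf (-p)
    have h5 : ‖(1 / 2 : ℝ)‖ = 1 / 2 := by norm_num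
    rw [h5]
    have h6 : ((-p : Sph n) : Eu n) = -p := rfl
    rw [h6] at h4
    linarith
  let Ψ : Eu n → Eu n := fun x => -h (‖x‖⁻¹ • x) + (‖x‖ - 10) • (‖x‖⁻¹ • x)
  have hnd : ∀ x : Eu n, x ≠ 0 → DifferentiableAt ℝ (fun x : Eu n => ‖x‖) x := fun x hx =>
    (contDiffAt_norm ℝ hx).differentiableAt one_ne_zero
  have hΨ : ∀ x ∈ ({0}ᶜ : Set (Eu n)), DifferentiableAt ℝ Ψ x := fun x hx =>
    (((hh.differentiable one_ne_zero _).comp x (hasFDerivAt_inv_norm_smul hx)).neg).add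
      (((hnd x hx).sub_const _).smul (hasFDerivAt_inv_norm_smul hx))
  obtain ⟨w, hw, hwreg⟩ := (volume : Measure (Eu n)).exists_mem_notMem_of_measure_zero
    (isOpen_ball (x := (0 : Eu n)) (ε := 1 / 8)) ⟨0, by simp⟩ (addHaar_image_critical_eq_zero volume hΨ)
  rw [mem_ball_zero_iff] at hw
  let F : Eu n → Eu n := fun x => h x + (w - ⟪w, x⟫ • x)
  have hwp : ∀ p : Sph n, |⟪w, (p : Eu n)⟫| ≤ ‖w‖ := fun p => by
    have := abs_real_inner_le_norm w (p : Eu n)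
    rwa [Sph.norm_coe, mul_one] at this
  refine ⟨F, hh.add (contDiff_const.sub ((contDiff_const.inner ℝ contDiff_id).smul contDiff_id)),
    fun p => ?_, fun x hx3 hx8 hx0 => ?_, fun p => ?_⟩
  · simp only [F, hhs]
    simp only [Refl, inner_add_right, inner_sub_right, inner_smul_right, inner_neg_right, hpp,
      real_inner_comm w (p : Eu n)]
    module
  · have hne : ∀ y : Eu n, 3 < ‖y‖ → y ≠ 0 := fun y hy h => by
      rw [h, norm_zero] at hy; linarith
    let ρ : Eu n → Eu n := fun x => (13 + ⟪w, ‖x‖⁻¹ • x⟫ - ‖x‖) • (‖x‖⁻¹ • x)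
    have hpos : ∀ y : Eu n, 3 < ‖y‖ → ‖y‖ < 8 → 3 < 13 + ⟪w, ‖y‖⁻¹ • y⟫ - ‖y‖ := fun y hy hy' => by
      have := hwp (toSph y)
      rw [coe_toSph (hne y hy)] at this
      linarith [(abs_le.1 this).1]
    have hρn : ∀ y : Eu n, 3 < ‖y‖ → ‖y‖ < 8 → ‖ρ y‖ = 13 + ⟪w, ‖y‖⁻¹ • y⟫ - ‖y‖ := fun y hy hy' => by
      have h1 := Sph.norm_coe (toSph y)
      rw [coe_toSph (hne y hy)] at h1
      rw [norm_smul, h1, mul_one, Real.norm_of_nonneg (by linarith [hpos y hy hy'])]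
    have hρN : ∀ y : Eu n, 3 < ‖y‖ → ‖y‖ < 8 → ‖ρ y‖⁻¹ • ρ y = ‖y‖⁻¹ • y := fun y hy hy' => by
      rw [hρn y hy hy']
      simp only [ρ]
      rw [smul_smul, inv_mul_cancel₀ (by linarith [hpos y hy hy']), one_smul]
    have hopen : {y : Eu n | 3 < ‖y‖ ∧ ‖y‖ < 8} ∈ 𝓝 x :=
      ((isOpen_lt continuous_const continuous_norm).inter
        (isOpen_lt continuous_norm continuous_const)).mem_nhds ⟨hx3, hx8⟩
    have hρρ : ρ ∘ ρ =ᶠ[𝓝 x] id := by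
      filter_upwards [hopen] with y hy
      simp only [Function.comp, id]
      rw [show ρ (ρ y) = (13 + ⟪w, ‖ρ y‖⁻¹ • ρ y⟫ - ‖ρ y‖) • (‖ρ y‖⁻¹ • ρ y) from rfl,
        hρN y hy.1 hy.2, hρn y hy.1 hy.2, smul_smul]
      rw [show (13 + ⟪w, ‖y‖⁻¹ • y⟫ - (13 + ⟪w, ‖y‖⁻¹ • y⟫ - ‖y‖)) = ‖y‖ by ring,
        mul_inv_cancel₀ (norm_ne_zero_iff.2 (hne y hy.1)), one_smul]
    have hΨρ : ∀ y : Eu n, 3 < ‖y‖ → ‖y‖ < 8 → shellMap F y = w - Ψ (ρ y) := fun y hy hy' => by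
      simp only [Ψ, shellMap]
      rw [hρN y hy hy', hρn y hy hy']
      simp only [F]
      module
    have hρx : ρ x ≠ 0 := hne _ (by rw [hρn x hx3 hx8]; exact hpos x hx3 hx8)
    have hρd : ∀ y : Eu n, y ≠ 0 → DifferentiableAt ℝ ρ y := fun y hy =>
      (((((differentiableAt_const w).inner ℝ (hasFDerivAt_inv_norm_smul hy)).const_add 13).sub
        (hnd y hy)).smul (hasFDerivAt_inv_norm_smul hy))
    have hd1 := (hρd (ρ x) hρx).hasFDerivAt.comp x (hρd x (hne x hx3)).hasFDerivAt
    have hd2 := (hρρ.symm.hasFDerivAt_iff.2 hd1).unique (hasFDerivAt_id x)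
    have hd3 : (fderiv ℝ ρ (ρ x)).det * (fderiv ℝ ρ x).det = 1 := by
      have := congrArg ContinuousLinearMap.det hd2
      simpa [ContinuousLinearMap.det, LinearMap.det_comp] using this
    have hd4 : HasFDerivAt (shellMap F) (-((fderiv ℝ Ψ (ρ x)).comp (fderiv ℝ ρ x))) x := by
      refine HasFDerivAt.congr_of_eventuallyEq (f := fun y => w - Ψ (ρ y)) ?_ ?_
      · exact ((hΨ _ hρx).hasFDerivAt.comp x (hρd x (hne x hx3)).hasFDerivAt).const_sub w
      · filter_upwards [hopen] with y hy using hΨρ y hy.1 hy.2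
    rw [hd4.fderiv]
    have hwx : Ψ (ρ x) = w := (sub_eq_zero.1 ((hΨρ x hx3 hx8).symm.trans hx0)).symm
    have hd5 : (fderiv ℝ Ψ (ρ x)).det ≠ 0 := fun h0 => hwreg ⟨ρ x, ⟨hρx, h0⟩, hwx⟩
    have hd6 : (fderiv ℝ ρ x).det ≠ 0 := right_ne_zero_of_mul (hd3.trans_ne one_ne_zero)
    rw [← neg_one_smul ℝ, ContinuousLinearMap.det, ContinuousLinearMap.toLinearMap_smul,
      LinearMap.det_smul, ContinuousLinearMap.toLinearMap_comp, LinearMap.det_comp]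
    exact mul_ne_zero (pow_ne_zero _ (by norm_num)) (mul_ne_zero hd5 hd6)
  · have h1 : F p - f p = (h p - f p) + (w - ⟪w, (p : Eu n)⟫ • (p : Eu n)) := by
      simp only [F]; abel
    rw [h1]
    have h2 := norm_add_le (h p - f p) (w - ⟪w, (p : Eu n)⟫ • (p : Eu n))
    have h3 := norm_sub_le w (⟪w, (p : Eu n)⟫ • (p : Eu n))
    rw [norm_smul, Sph.norm_coe, mul_one, Real.norm_eq_abs] at h3
    linarith [hwp p, hhf p]

theorem sum_sign_of_homotopic_equivariant {n : ℕ} {f : C(Sph n, Sph n)}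
    (hfs : ∀ p : Sph n, (f (-p) : Eu n) = Refl (p : Eu n) (f p : Eu n)) {L : Eu n → Eu n}
    (hL : ContDiff ℝ 1 L) {r : ℝ} (hr : r < 1) (hLr : ∀ x, ‖x‖ ≤ 1 → L x = 0 → ‖x‖ < r)
    (hLreg : ∀ x, ‖x‖ ≤ 1 → L x = 0 → (fderiv ℝ L x).det ≠ 0)
    {l : C(Sph n, PuncturedEu n)} (hl : ∀ p : Sph n, (l p : Eu n) = L p)
    (hlf : l.Homotopic ((Sph.incl n).comp f)) :
    ∃ Z : Finset (Eu n), (∀ x, x ∈ Z ↔ ‖x‖ ≤ 1 ∧ L x = 0) ∧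
      Odd (∑ z ∈ Z, (SignType.sign (fderiv ℝ L z).det : ℤ)) ∧
      (Odd n → ∑ z ∈ Z, (SignType.sign (fderiv ℝ L z).det : ℤ) = 1) := by
  obtain ⟨F, hF, hsym, hreg, hFf⟩ := exists_regular_equivariant_approx f hfs
  have hb : ∀ p : Sph n, 1 / 2 ≤ ‖F p‖ ∧ ‖F p‖ ≤ 2 := fun p => by
    have h1 := hFf p
    have h2 := Sph.norm_coe (f p)
    have h3 := norm_sub_norm_le (f p : Eu n) (F p)
    have h4 := norm_sub_norm_le (F p) (f p : Eu n)
    rw [norm_sub_rev] at h3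
    constructor <;> linarith
  let F' := Sph.toPunctured F (hF.continuous.comp continuous_subtype_val) fun p h => by
    have := (hb p).1
    rw [h, norm_zero] at this
    linarith
  refine sum_sign_of_homotopic hF hsym hreg (fun p => (hb p).1) (fun p => (hb p).2) hL hr hLr hLreg
    hl (f := F') (fun p => rfl) (hlf.trans ?_)
  refine PuncturedEu.homotopic_of_norm_sub_lt _ _ fun p => ?_
  have h2 : ‖(((Sph.incl n).comp f p : PuncturedEu n) : Eu n)‖ = 1 := Sph.norm_coe (f p)
  rw [h2]
  exact (hFf p).trans (by norm_num)

theorem not_homotopic_const_of_equivariant {n : ℕ} {f : C(Sph n, Sph n)}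
    (hfs : ∀ p : Sph n, (f (-p) : Eu n) = Refl (p : Eu n) (f p : Eu n)) (y : Sph n) :
    ¬ f.Homotopic (ContinuousMap.const (Sph n) y) := fun h => by
  obtain ⟨Z, hZ, hodd, -⟩ := sum_sign_of_homotopic_equivariant hfs (L := fun _ => (y : Eu n))
    contDiff_const zero_lt_one (fun x _ h0 => absurd h0 (Sph.coe_ne_zero y))
    (fun x _ h0 => absurd h0 (Sph.coe_ne_zero y))
    (l := (Sph.incl n).comp (ContinuousMap.const (Sph n) y)) (fun _ => rfl)
    ((Sph.homotopic_iff _ _).1 h.symm)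
  have : Z = ∅ := Finset.eq_empty_of_forall_notMem fun x hx =>
    Sph.coe_ne_zero y ((hZ x).1 hx).2
  rw [this, Finset.sum_empty] at hodd
  simp at hodd

/-- The complex coordinate formed by the first two real coordinates. -/
def planeProj (m : ℕ) : Eu (m + 1) →L[ℝ] ℂ :=
  (EuclideanSpace.proj 0 : Eu (m + 1) →L[ℝ] ℝ).smulRight 1 +
    (EuclideanSpace.proj 1 : Eu (m + 1) →L[ℝ] ℝ).smulRight Complex.I

/-- The inclusion of the plane of the first two coordinates. -/
def planeIncl (m : ℕ) : ℂ →L[ℝ] Eu (m + 1) :=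
  Complex.reCLM.smulRight (EuclideanSpace.single 0 1) +
    Complex.imCLM.smulRight (EuclideanSpace.single 1 1)

@[simp] theorem planeProj_planeIncl (m : ℕ) (z : ℂ) : planeProj m (planeIncl m z) = z := by
  apply Complex.ext <;> simp [planeProj, planeIncl]

theorem norm_planeIncl (m : ℕ) (z : ℂ) : ‖planeIncl m z‖ = ‖z‖ := by
  rw [EuclideanSpace.norm_eq, Complex.norm_eq_sqrt_sq_add_sq, Fin.sum_univ_succ, Fin.sum_univ_succ]
  have h (i : Fin m) : i.succ.succ ≠ 1 := by simp [Fin.ext_iff]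
  simp [planeIncl, h]

/-- Apply a map to the first two coordinates. -/
def onPlane (m : ℕ) (φ : ℂ → ℂ) (x : Eu (m + 1)) : Eu (m + 1) :=
  x + planeIncl m (φ (planeProj m x) - planeProj m x)

theorem planeProj_onPlane (m : ℕ) (φ : ℂ → ℂ) (x : Eu (m + 1)) :
    planeProj m (onPlane m φ x) = φ (planeProj m x) := by
  simp [onPlane]

theorem onPlane_eq_zero {m : ℕ} {φ : ℂ → ℂ} {x : Eu (m + 1)} :
    onPlane m φ x = 0 ↔ ∃ z, x = planeIncl m z ∧ φ z = 0 := by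
  constructor
  · intro h
    have h1 : φ (planeProj m x) = 0 := by rw [← planeProj_onPlane m φ x, h, map_zero]
    refine ⟨planeProj m x, ?_, h1⟩
    rw [onPlane, h1, zero_sub, map_neg] at h
    exact eq_of_sub_eq_zero (by rw [← h]; abel)
  · rintro ⟨z, rfl, hz⟩
    simp [onPlane, hz]

theorem continuous_onPlane {m : ℕ} {φ : ℂ → ℂ} (hφ : Continuous φ) : Continuous (onPlane m φ) := by
  unfold onPlane; fun_prop

/-- Apply a linear map to the first two coordinates. -/
def onPlaneL (m : ℕ) (A : ℂ →L[ℝ] ℂ) : Eu (m + 1) →L[ℝ] Eu (m + 1) :=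
  ContinuousLinearMap.id ℝ _ + (planeIncl m).comp ((A - ContinuousLinearMap.id ℝ ℂ).comp (planeProj m))

theorem onPlaneL_comp (m : ℕ) (A B : ℂ →L[ℝ] ℂ) :
    onPlaneL m (A.comp B) = (onPlaneL m A).comp (onPlaneL m B) := by
  ext1 x
  simp [onPlaneL]
  abel

theorem HasFDerivAt.onPlane {m : ℕ} {φ : ℂ → ℂ} {A : ℂ →L[ℝ] ℂ} {x : Eu (m + 1)}
    (h : HasFDerivAt φ A (planeProj m x)) : HasFDerivAt (onPlane m φ) (onPlaneL m A) x :=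
  (hasFDerivAt_id x).add ((planeIncl m).hasFDerivAt.comp x
    ((h.comp x (planeProj m).hasFDerivAt).sub (planeProj m).hasFDerivAt))

theorem det_onPlaneL_comp (m : ℕ) (A B : ℂ →L[ℝ] ℂ) :
    (onPlaneL m (A.comp B)).det = (onPlaneL m A).det * (onPlaneL m B).det := by
  rw [onPlaneL_comp, ContinuousLinearMap.det, ContinuousLinearMap.toLinearMap_comp,
    LinearMap.det_comp]

theorem det_onPlaneL_id (m : ℕ) : (onPlaneL m (ContinuousLinearMap.id ℝ ℂ)).det = 1 := by
  simp [onPlaneL, ContinuousLinearMap.det]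

theorem det_onPlaneL_mul_pos (m : ℕ) {w : ℂ} (hw : w ≠ 0) :
    0 < (onPlaneL m (ContinuousLinearMap.mul ℝ ℂ w)).det := by
  obtain ⟨u, rfl⟩ := IsAlgClosed.exists_eq_mul_self w
  have h1 : ContinuousLinearMap.mul ℝ ℂ (u * u) =
      (ContinuousLinearMap.mul ℝ ℂ u).comp (ContinuousLinearMap.mul ℝ ℂ u) := by
    ext1 x; simp [mul_assoc]
  have h2 : ContinuousLinearMap.id ℝ ℂ =
      (ContinuousLinearMap.mul ℝ ℂ u⁻¹).comp (ContinuousLinearMap.mul ℝ ℂ u) := by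
    ext1 x; simp [inv_mul_cancel_left₀ (left_ne_zero_of_mul hw)]
  have h3 := det_onPlaneL_id m
  rw [h2, det_onPlaneL_comp] at h3
  rw [h1, det_onPlaneL_comp]
  exact mul_self_pos.2 (right_ne_zero_of_mul (h3 ▸ one_ne_zero))

theorem det_onPlaneL_conj (m : ℕ) :
    (onPlaneL m (Complex.conjCLE : ℂ →L[ℝ] ℂ)).det = -1 := by
  have : (onPlaneL m (Complex.conjCLE : ℂ →L[ℝ] ℂ) : Eu (m + 1) →ₗ[ℝ] Eu (m + 1)) =
      LinearMap.transvection ((-2 : ℝ) • ((Complex.imCLM.comp (planeProj m) :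
        Eu (m + 1) →L[ℝ] ℝ) : Eu (m + 1) →ₗ[ℝ] ℝ)) (planeIncl m Complex.I) := by
    ext1 x
    have : (starRingEnd ℂ) (planeProj m x) - planeProj m x =
        (-2 * (planeProj m x).im : ℝ) • Complex.I := by
      apply Complex.ext <;> simp; ring
    simp [onPlaneL, LinearMap.transvection, ← map_sub, this]
    rw [← map_smul]
    congr 1
    simp
  rw [ContinuousLinearMap.det, this, LinearMap.transvection.det]
  simp; norm_num

/-- The radial extension of `z ↦ z ^ k` from the unit circle to the plane. -/
def windMap (k : ℤ) (z : ℂ) : ℂ := ‖z‖ * (z / ‖z‖) ^ k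

theorem norm_windMap (k : ℤ) (z : ℂ) : ‖windMap k z‖ = ‖z‖ := by
  rcases eq_or_ne z 0 with rfl | hz
  · simp [windMap]
  · simp [windMap, hz]

theorem windMap_of_norm_one (k : ℤ) {z : ℂ} (hz : ‖z‖ = 1) : windMap k z = z ^ k := by
  simp [windMap, hz]

theorem windMap_smul (k : ℤ) {t : ℝ} (ht : 0 ≤ t) (z : ℂ) :
    windMap k (t • z) = t • windMap k z := by
  rcases ht.eq_or_lt with rfl | ht
  · simp [windMap]
  · have : (t : ℂ) ≠ 0 := by exact_mod_cast ht.ne'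
    have hn : ‖t • z‖ = t * ‖z‖ := by rw [norm_smul, Real.norm_of_nonneg ht.le]
    rw [windMap, hn, windMap, Complex.real_smul, Complex.real_smul, Complex.ofReal_mul,
      mul_div_mul_left _ _ this, mul_assoc]

theorem windMap_one (z : ℂ) : windMap 1 z = z := by
  rcases eq_or_ne z 0 with rfl | hz
  · simp [windMap]
  · have : (‖z‖ : ℂ) ≠ 0 := by simpa
    simp [windMap, mul_div_cancel₀ _ this]

theorem continuous_windMap (k : ℤ) : Continuous (windMap k) := by
  refine continuous_iff_continuousAt.2 fun z => ?_
  rcases eq_or_ne z 0 with rfl | hz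
  · have h0 : windMap k 0 = 0 := by simp [windMap]
    rw [ContinuousAt, h0, tendsto_zero_iff_norm_tendsto_zero]
    simp only [norm_windMap]
    exact tendsto_norm_zero
  · have h : (‖z‖ : ℂ) ≠ 0 := by simpa
    have hc : ContinuousAt (fun w : ℂ => (‖w‖ : ℂ)) z := by fun_prop
    exact hc.mul ((continuousAt_id.div hc h).zpow₀ k (Or.inl (div_ne_zero hz h)))

theorem onPlane_ne_zero {m : ℕ} {φ : ℂ → ℂ} (h : ∀ z, ‖z‖ = 1 → φ z ≠ 0) (p : Sph (m + 1)) :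
    onPlane m φ p ≠ 0 := fun h0 => by
  obtain ⟨z, hz, hφ⟩ := onPlane_eq_zero.1 h0
  refine h z ?_ hφ
  rw [← norm_planeIncl m, ← hz, Sph.norm_coe]

/-- The map of the sphere into punctured space given by a plane map without zeros on the circle. -/
def onPlaneSph (m : ℕ) (φ : ℂ → ℂ) (hφ : Continuous φ) (h : ∀ z, ‖z‖ = 1 → φ z ≠ 0) :
    C(Sph (m + 1), PuncturedEu (m + 1)) :=
  Sph.toPunctured (fun p => onPlane m φ p) ((continuous_onPlane hφ).comp continuous_subtype_val)
    (onPlane_ne_zero h)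

theorem onPlane_convex (m : ℕ) (φ ψ : ℂ → ℂ) (t : ℝ) (x : Eu (m + 1)) :
    (1 - t) • onPlane m φ x + t • onPlane m ψ x =
      onPlane m (fun z => (1 - t) • φ z + t • ψ z) x := by
  simp only [onPlane, smul_add, ← map_smul, smul_sub, map_add, map_sub, sub_smul, one_smul]
  abel

theorem onPlaneSph_homotopic {m : ℕ} {φ ψ : ℂ → ℂ} {hφ : Continuous φ} {hψ : Continuous ψ}
    {hφ0 : ∀ z, ‖z‖ = 1 → φ z ≠ 0} {hψ0 : ∀ z, ‖z‖ = 1 → ψ z ≠ 0}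
    (h : ∀ z, ‖z‖ = 1 → ‖ψ z - φ z‖ < ‖φ z‖) :
    (onPlaneSph m φ hφ hφ0).Homotopic (onPlaneSph m ψ hψ hψ0) := by
  refine PuncturedEu.homotopic_of_segment _ _ fun p t ht => ?_
  change (1 - t) • onPlane m φ p + t • onPlane m ψ p ≠ 0
  rw [onPlane_convex]
  refine onPlane_ne_zero (fun z hz h0 => ?_) p
  have h1 := h z hz
  have h2 : φ z = -(t • (ψ z - φ z)) := by
    rw [← sub_eq_zero, ← h0, sub_smul, one_smul, smul_sub]; abel
  have h3 : ‖φ z‖ ≤ ‖ψ z - φ z‖ := by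
    conv_lhs => rw [h2, norm_neg, norm_smul, Real.norm_of_nonneg ht.1]
    exact mul_le_of_le_one_left (norm_nonneg _) ht.2
  linarith

theorem mul_eq_one_of_homotopic_pow {m : ℕ} {f : C(Sph (m + 1), Sph (m + 1))}
    (hfs : ∀ p : Sph (m + 1), (f (-p) : Eu (m + 1)) = Refl (p : Eu (m + 1)) (f p : Eu (m + 1)))
    (hm : Odd (m + 1)) {σ : ℂ →L[ℝ] ℂ} (hσ : ∀ z, σ (σ z) = z) (hn : ∀ z, ‖σ z‖ = ‖z‖)
    {s : SignType} (hs : SignType.sign (onPlaneL m σ).det = s) (hs0 : s ≠ 0) {j : ℕ} (hj : j ≠ 0)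
    {hc : Continuous fun z => σ z ^ j} {h0 : ∀ z, ‖z‖ = 1 → σ z ^ j ≠ 0}
    (hlf : (onPlaneSph m (fun z => σ z ^ j) hc h0).Homotopic ((Sph.incl (m + 1)).comp f)) :
    (j : ℤ) * s = 1 := by
  set ε : ℂ := 1 / 2 with hε
  have hε0 : ε ≠ 0 := by norm_num [hε]
  have hεn : ‖ε‖ = 1 / 2 := by norm_num [hε]
  set ψ : ℂ → ℂ := fun z => σ z ^ j - ε ^ j with hψ
  have hεj : ‖ε ^ j‖ < 1 := by
    rw [norm_pow, hεn]; exact pow_lt_one₀ (by norm_num) (by norm_num) hj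
  have hψc : Continuous ψ := by fun_prop
  have hψ0 : ∀ z, ‖z‖ = 1 → ψ z ≠ 0 := fun z hz h => by
    have := congrArg norm (sub_eq_zero.1 h)
    rw [norm_pow, hn, hz, one_pow] at this
    linarith
  have hroot : ∀ z, ψ z = 0 → ‖z‖ = 1 / 2 := fun z h => by
    have := congrArg norm (sub_eq_zero.1 h)
    rw [norm_pow, norm_pow, hn, hεn] at this
    exact (pow_left_inj₀ (norm_nonneg _) (by norm_num) hj).1 this
  have hder : ∀ x : Eu (m + 1), HasFDerivAt (onPlane m ψ) (onPlaneL m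
      ((ContinuousLinearMap.mul ℝ ℂ (j * σ (planeProj m x) ^ (j - 1))).comp σ)) x := fun x => by
    refine HasFDerivAt.onPlane ?_
    refine HasFDerivAt.congr_fderiv ((((hasDerivAt_pow j (σ (planeProj m x))).hasFDerivAt
      |>.restrictScalars ℝ).comp _ σ.hasFDerivAt).sub_const (ε ^ j)) ?_
    ext1 y
    simp [mul_comm]
  have hsign : ∀ x : Eu (m + 1), onPlane m ψ x = 0 →
      SignType.sign (fderiv ℝ (onPlane m ψ) x).det = s := fun x hx => by
    obtain ⟨z, rfl, hz⟩ := onPlane_eq_zero.1 hx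
    have hz0 : z ≠ 0 := by
      rintro rfl
      have := hroot 0 hz
      norm_num at this
    have hw : (j * σ z ^ (j - 1) : ℂ) ≠ 0 := by
      refine mul_ne_zero (by exact_mod_cast hj) (pow_ne_zero _ fun h => hz0 ?_)
      rw [← hσ z, h, map_zero]
    rw [(hder _).fderiv, det_onPlaneL_comp, planeProj_planeIncl, sign_mul,
      sign_pos (det_onPlaneL_mul_pos m hw), one_mul, hs]
  obtain ⟨Z, hZ, -, hsum⟩ := sum_sign_of_homotopic_equivariant hfs (L := onPlane m ψ) (r := 3 / 4)
    (by unfold onPlane; fun_prop) (by norm_num)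
    (fun x _ hx => by
      obtain ⟨z, rfl, hz⟩ := onPlane_eq_zero.1 hx
      rw [norm_planeIncl, hroot z hz]; norm_num)
    (fun x _ hx h => by
      have := hsign x hx
      rw [h, sign_zero] at this
      exact hs0 this.symm)
    (l := onPlaneSph m ψ hψc hψ0) (fun p => rfl)
    ((onPlaneSph_homotopic fun z hz => by
      simp only [hψ, sub_sub_cancel_left, norm_neg, norm_pow (σ z), hn, hz, one_pow]
      exact hεj).symm.trans hlf)
  have hcard : Z = (Polynomial.nthRootsFinset j (1 : ℂ)).image fun u => planeIncl m (σ (ε * u)) := by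
    ext x
    rw [hZ, Finset.mem_image]
    constructor
    · rintro ⟨-, hx⟩
      obtain ⟨z, rfl, hz⟩ := onPlane_eq_zero.1 hx
      refine ⟨σ z / ε, ?_, ?_⟩
      · rw [Polynomial.mem_nthRootsFinset (Nat.pos_of_ne_zero hj), div_pow, sub_eq_zero.1 hz,
          div_self (pow_ne_zero _ hε0)]
      · rw [mul_div_cancel₀ _ hε0, hσ]
    · rintro ⟨u, hu, rfl⟩
      rw [Polynomial.mem_nthRootsFinset (Nat.pos_of_ne_zero hj)] at hu
      have hz : ψ (σ (ε * u)) = 0 := by simp [hψ, hσ, mul_pow, hu]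
      refine ⟨?_, onPlane_eq_zero.2 ⟨_, rfl, hz⟩⟩
      rw [norm_planeIncl, hroot _ hz]; norm_num
  have hinj : Function.Injective fun u => planeIncl m (σ (ε * u)) := fun u v huv => by
    have h1 := congrArg (fun x => σ (planeProj m x)) huv
    simp only [planeProj_planeIncl, hσ] at h1
    exact mul_left_cancel₀ hε0 h1
  have h1 := hsum hm
  rw [Finset.sum_congr rfl fun z hz => by rw [hsign z ((hZ z).1 hz).2], Finset.sum_const, hcard,
    Finset.card_image_of_injective _ hinj,
    (Complex.isPrimitiveRoot_exp j hj).card_nthRootsFinset, nsmul_eq_mul] at h1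
  exact h1

/-- The `k`-fold winding map of the sphere around the subspace orthogonal to the plane. -/
def windSph (m : ℕ) (k : ℤ) : C(Sph (m + 1), PuncturedEu (m + 1)) :=
  onPlaneSph m (windMap k) (continuous_windMap k) fun z hz h => by
    rw [← norm_eq_zero, norm_windMap, hz] at h
    exact one_ne_zero h

theorem windSph_one (m : ℕ) : windSph m 1 = Sph.incl (m + 1) := by
  ext1 p
  apply Subtype.ext
  change onPlane m (windMap 1) p = p
  simp [onPlane, windMap_one]

theorem onPlaneSph_homotopic_of_eq {m : ℕ} {φ ψ : ℂ → ℂ} {hφ : Continuous φ} {hψ : Continuous ψ}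
    {hφ0 : ∀ z, ‖z‖ = 1 → φ z ≠ 0} {hψ0 : ∀ z, ‖z‖ = 1 → ψ z ≠ 0}
    (h : ∀ z, ‖z‖ = 1 → φ z = ψ z) :
    (onPlaneSph m φ hφ hφ0).Homotopic (onPlaneSph m ψ hψ hψ0) :=
  onPlaneSph_homotopic fun z hz => by simpa [h z hz] using hψ0 z hz

theorem eq_one_of_homotopic_windSph {m : ℕ} {f : C(Sph (m + 1), Sph (m + 1))}
    (hfs : ∀ p : Sph (m + 1), (f (-p) : Eu (m + 1)) = Refl (p : Eu (m + 1)) (f p : Eu (m + 1)))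
    (hm : Odd (m + 1)) {k : ℤ} (h : (windSph m k).Homotopic ((Sph.incl (m + 1)).comp f)) :
    k = 1 := by
  have hnz : ∀ (j : ℕ) (z : ℂ), ‖z‖ = 1 → z ^ j ≠ 0 := fun j z hz =>
    pow_ne_zero _ (norm_ne_zero_iff.1 (hz ▸ one_ne_zero))
  rcases lt_trichotomy k 0 with hk | rfl | hk
  · obtain ⟨j, hj⟩ := Int.eq_ofNat_of_zero_le (neg_nonneg.2 hk.le)
    obtain rfl : k = -j := by omega
    have := mul_eq_one_of_homotopic_pow hfs hm (σ := (Complex.conjCLE : ℂ →L[ℝ] ℂ))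
      (fun _ => by simp) (fun _ => by simp) (s := -1)
      (by rw [det_onPlaneL_conj]; simp) (by decide) (j := j) (by omega)
      (hc := by fun_prop) (h0 := fun z hz => hnz j _ (by simpa))
      ((onPlaneSph_homotopic_of_eq fun z hz => by
        have hc : starRingEnd ℂ z = z⁻¹ := by
          rw [Complex.inv_def, Complex.normSq_eq_norm_sq, hz]; simp
        simp [windMap, hz, hc]).trans h)
    simpa using this
  · obtain ⟨Z, hZ, hodd, -⟩ := sum_sign_of_homotopic_equivariant hfs
      (L := onPlane m fun _ => 1) (r := 1 / 2) (by unfold onPlane; fun_prop) (by norm_num)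
      (fun x _ hx => by obtain ⟨z, rfl, hz⟩ := onPlane_eq_zero.1 hx; exact absurd hz one_ne_zero)
      (fun x _ hx => by obtain ⟨z, rfl, hz⟩ := onPlane_eq_zero.1 hx; exact absurd hz one_ne_zero)
      (l := onPlaneSph m (fun _ => 1) continuous_const fun _ _ => one_ne_zero) (fun _ => rfl)
      ((onPlaneSph_homotopic_of_eq fun z hz => by simp [windMap, hz]).trans h)
    have : Z = ∅ := Finset.eq_empty_of_forall_notMem fun x hx => by
      obtain ⟨z, rfl, hz⟩ := onPlane_eq_zero.1 ((hZ x).1 hx).2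
      exact absurd hz one_ne_zero
    simp [this] at hodd
  · obtain ⟨j, rfl⟩ := Int.eq_ofNat_of_zero_le hk.le
    have := mul_eq_one_of_homotopic_pow hfs hm (σ := ContinuousLinearMap.id ℝ ℂ) (fun _ => rfl)
      (fun _ => rfl) (s := 1) (by rw [det_onPlaneL_id, sign_one]) (by decide) (j := j) (by omega)
      (hc := by fun_prop) (h0 := hnz j)
      ((onPlaneSph_homotopic_of_eq fun z hz => by simp [windMap, hz]).trans h)
    simpa using this

theorem planeIncl_planeProj_zero (x : Eu (0 + 1)) : planeIncl 0 (planeProj 0 x) = x := by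
  ext i
  fin_cases i <;> simp [planeIncl, planeProj]

theorem norm_planeProj_zero (x : Eu (0 + 1)) : ‖planeProj 0 x‖ = ‖x‖ := by
  rw [← norm_planeIncl 0, planeIncl_planeProj_zero]

/-- A loop in the circle, given by a continuous function of the angle, has an angular lift on the
unit circle after dividing by a suitable power. -/
theorem exists_angle_eq {γ : ℝ → Circle} (hγ : Continuous γ) (h : γ (-Real.pi) = γ Real.pi) :
    ∃ (k : ℤ) (v : ℝ → ℝ), Continuous v ∧ v (-Real.pi) = v Real.pi ∧
      ∀ θ, γ θ = Circle.exp (v θ + k * θ) := by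
  obtain ⟨e, he⟩ := Circle.exp_surjective (γ 0)
  obtain ⟨u, ⟨-, hu⟩, -⟩ := Circle.isCoveringMap_exp.existsUnique_continuousMap_lifts ⟨γ, hγ⟩ 0 e he
  replace hu : ∀ θ, Circle.exp (u θ) = γ θ := fun θ => congrFun hu θ
  have h1 : Circle.exp (u Real.pi) = Circle.exp (u (-Real.pi)) := by rw [hu, hu, h]
  obtain ⟨k, hk⟩ := Circle.exp_eq_exp.1 h1
  refine ⟨k, fun θ => u θ - k * θ, by fun_prop, ?_, fun θ => ?_⟩
  · simp only [hk]; ring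
  · rw [sub_add_cancel, hu]

/-- The angle in `[-π, π]` of a point of the circle. -/
def circleAngle (z : ℂ) : ℝ := if 0 ≤ z.im then Real.arccos z.re else -Real.arccos z.re

theorem exp_circleAngle {z : ℂ} (hz : ‖z‖ = 1) : Complex.exp (circleAngle z * Complex.I) = z := by
  have h : z.re ^ 2 + z.im ^ 2 = 1 := by
    rw [Complex.norm_eq_sqrt_sq_add_sq, Real.sqrt_eq_one] at hz; exact hz
  have h1 : 1 - z.re ^ 2 = z.im ^ 2 := by linarith
  have hc : Real.cos (Real.arccos z.re) = z.re :=
    Real.cos_arccos (by nlinarith) (by nlinarith)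
  have hs : Real.sin (Real.arccos z.re) = |z.im| := by
    rw [Real.sin_arccos, h1, Real.sqrt_sq_eq_abs]
  apply Complex.ext
  · rw [Complex.exp_ofReal_mul_I_re, circleAngle]
    split_ifs <;> simp [hc]
  · rw [Complex.exp_ofReal_mul_I_im, circleAngle]
    split_ifs with h0
    · rw [hs, abs_of_nonneg h0]
    · rw [Real.sin_neg, hs, abs_of_neg (not_le.1 h0), neg_neg]

theorem continuous_comp_circleAngle {v : ℝ → ℝ} (hv : Continuous v)
    (h : v (-Real.pi) = v Real.pi) : Continuous fun z : Circle => v (circleAngle z) := by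
  have : (fun z : Circle => v (circleAngle z)) = fun z : Circle =>
      if 0 ≤ (z : ℂ).im then v (Real.arccos (z : ℂ).re) else v (-Real.arccos (z : ℂ).re) := by
    ext z
    rw [circleAngle]
    split_ifs <;> rfl
  rw [this]
  have hre : Continuous fun z : Circle => (z : ℂ).re :=
    Complex.continuous_re.comp continuous_subtype_val
  refine Continuous.if_le (hv.comp (Real.continuous_arccos.comp hre))
    (hv.comp (Real.continuous_arccos.comp hre).neg) continuous_const
    (Complex.continuous_im.comp continuous_subtype_val) fun z hz => ?_
  have h1 : ‖(z : ℂ)‖ = 1 := z.norm_coe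
  rw [Complex.norm_eq_sqrt_sq_add_sq, Real.sqrt_eq_one, ← hz] at h1
  have h2 : ((z : ℂ).re - 1) * ((z : ℂ).re + 1) = 0 := by linarith
  rcases mul_eq_zero.1 h2 with h3 | h3
  · rw [sub_eq_zero.1 h3]; simp
  · rw [eq_neg_of_add_eq_zero_left h3]; simp [h]

theorem exists_homotopic_windSph_zero (f : C(Sph (0 + 1), PuncturedEu (0 + 1))) :
    ∃ k, (windSph 0 k).Homotopic f := by
  let c : Circle → Sph (0 + 1) := fun z =>
    ⟨planeIncl 0 z, by rw [mem_sphere_zero_iff_norm, norm_planeIncl, z.norm_coe]⟩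
  have hc : Continuous c := by fun_prop
  let g : Circle → ℂ := fun z => planeProj 0 (f (c z))
  have hg : Continuous g :=
    (planeProj 0).continuous.comp (continuous_subtype_val.comp (f.continuous.comp hc))
  have hg0 : ∀ z, ‖g z‖ ≠ 0 := fun z h => (f (c z)).2 <| by
    rwa [← norm_eq_zero, ← norm_planeProj_zero]
  have hg0' : ∀ z, (‖g z‖ : ℂ) ≠ 0 := fun z => by exact_mod_cast hg0 z
  let γ : ℝ → Circle := fun θ => ⟨g (Circle.exp θ) / ‖g (Circle.exp θ)‖, by
    refine mem_sphere_zero_iff_norm.2 ?_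
    rw [norm_div, Complex.norm_real, norm_norm, div_self (hg0 _)]⟩
  have hγ : Continuous γ :=
    Continuous.subtype_mk ((hg.comp Circle.exp.continuous).div
      (Complex.continuous_ofReal.comp (hg.comp Circle.exp.continuous).norm) fun θ => hg0' _) _
  have hπ : Circle.exp (-Real.pi) = Circle.exp Real.pi :=
    Circle.exp_eq_exp.2 ⟨-1, by push_cast; ring⟩
  obtain ⟨k, v, hv, hvπ, hγv⟩ := exists_angle_eq hγ (by
    apply Circle.ext; simp only [γ, hπ])
  have hpn : ∀ p : Sph (0 + 1), ‖planeProj 0 p‖ = 1 := fun p => by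
    rw [norm_planeProj_zero, Sph.norm_coe]
  let ζ : Sph (0 + 1) → Circle := fun p =>
    ⟨planeProj 0 p, mem_sphere_zero_iff_norm.2 (hpn p)⟩
  have hζ : Continuous ζ := by fun_prop
  have hV : Continuous fun p => v (circleAngle (ζ p)) := (continuous_comp_circleAngle hv hvπ).comp hζ
  let H : unitInterval × Sph (0 + 1) → ℂ := fun q =>
    Complex.exp ((q.1 * v (circleAngle (ζ q.2)) : ℝ) * Complex.I) * windMap k (ζ q.2)
  have hζc : Continuous fun q : unitInterval × Sph (0 + 1) => (ζ q.2 : ℂ) := by fun_prop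
  have hH : Continuous H := by
    have h1 := hV.comp (continuous_snd (X := unitInterval))
    have h2 := (continuous_windMap k).comp hζc
    have h3 : Continuous fun q : unitInterval × Sph (0 + 1) => (q.1 : ℝ) := by fun_prop
    exact (Complex.continuous_exp.comp
      ((Complex.continuous_ofReal.comp (h3.mul h1)).mul continuous_const)).mul h2
  have hHn : ∀ q, ‖H q‖ = 1 := fun q => by
    rw [norm_mul, Complex.norm_exp_ofReal_mul_I, norm_windMap, Circle.norm_coe, one_mul]
  let H' : C(unitInterval × Sph (0 + 1), PuncturedEu (0 + 1)) :=
    ⟨fun q => ⟨planeIncl 0 (H q), fun h => by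
      have := hHn q
      rw [← norm_planeIncl 0, h, norm_zero] at this
      exact zero_ne_one this⟩, by fun_prop⟩
  let w : C(Sph (0 + 1), PuncturedEu (0 + 1)) := H'.comp ((ContinuousMap.const _ 1).prodMk (.id _))
  have hw1 : (windSph 0 k).Homotopic w := ⟨⟨H', fun p => Subtype.ext ?_, fun p => rfl⟩⟩
  · refine ⟨k, hw1.trans (PuncturedEu.homotopic_of_segment _ _ fun p t ht => ?_)⟩
    have hfw : ((f p : PuncturedEu (0 + 1)) : Eu (0 + 1)) = ‖g (ζ p)‖ • (w p : Eu (0 + 1)) := by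
      have hcζ : c (ζ p) = p := Subtype.ext (planeIncl_planeProj_zero p)
      have hexp : Circle.exp (circleAngle (ζ p)) = ζ p :=
        Circle.ext (by rw [Circle.coe_exp, exp_circleAngle (hpn p)])
      have h1 := congrArg (fun z : Circle => (z : ℂ)) (hγv (circleAngle (ζ p)))
      simp only [γ, hexp, Circle.coe_exp] at h1
      have h2 : H (1, p) = g (ζ p) / ‖g (ζ p)‖ := by
        rw [h1]
        simp only [H]
        rw [windMap_of_norm_one _ (Circle.norm_coe _)]
        have h4 : (ζ p : ℂ) ^ k = Complex.exp (circleAngle (ζ p) * Complex.I) ^ k := by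
          rw [exp_circleAngle (Circle.norm_coe _)]
        rw [h4, ← Complex.exp_int_mul, ← Complex.exp_add]
        congr 1
        push_cast
        simp only [ζ]
        ring
      have h3 : (w p : Eu (0 + 1)) = planeIncl 0 (H (1, p)) := rfl
      rw [h3, ← map_smul, h2, Complex.real_smul, mul_div_cancel₀ _ (hg0' _)]
      simp only [g, hcζ, planeIncl_planeProj_zero]
    rw [hfw, smul_smul, ← add_smul]
    refine smul_ne_zero ?_ (w p).2
    have := (norm_nonneg (g (ζ p))).lt_of_ne' (hg0 _)
    rcases ht.1.eq_or_lt with rfl | h0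
    · norm_num
    · exact (add_pos_of_nonneg_of_pos (sub_nonneg.2 ht.2) (mul_pos h0 this)).ne'
  · have h1 : H (0, p) = windMap k (planeProj 0 p) := by simp [H, ζ]
    change planeIncl 0 (H (0, p)) = onPlane 0 (windMap k) p
    rw [h1, ← planeProj_onPlane 0 (windMap k) p, planeIncl_planeProj_zero]

theorem continuous_norm_smul_toSph {T E : Type*} [TopologicalSpace T] [NormedAddCommGroup E]
    [NormedSpace ℝ E] {d : ℕ} {G : T × Sph d → E} (hG : Continuous G) {C : ℝ}
    (hC : ∀ q, ‖G q‖ ≤ C) : Continuous fun q : T × Eu d => ‖q.2‖ • G (q.1, toSph q.2) := by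
  refine continuous_iff_continuousAt.2 fun ⟨t, v⟩ => ?_
  rcases eq_or_ne v 0 with rfl | hv
  · have h : Tendsto (fun q : T × Eu d => ‖q.2‖ * C) (𝓝 (t, 0)) (𝓝 0) := by
      have : Continuous fun q : T × Eu d => ‖q.2‖ * C := by fun_prop
      simpa using this.tendsto (t, 0)
    rw [ContinuousAt, norm_zero, zero_smul]
    refine squeeze_zero_norm (fun q => ?_) h
    rw [norm_smul, norm_norm]
    exact mul_le_mul_of_nonneg_left (hC _) (norm_nonneg _)
  · have h : ContinuousAt (fun q : T × Eu d => toSph q.2) (t, v) :=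
      ContinuousAt.comp (g := toSph) (continuousOn_toSph.continuousAt (isOpen_ne.mem_nhds hv))
        continuousAt_snd
    exact continuousAt_snd.norm.smul (hG.continuousAt.comp (continuousAt_fst.prodMk h))

/-- Forget the last coordinate. -/
def euInit (d : ℕ) : Eu (d + 1) →L[ℝ] Eu d :=
  (EuclideanSpace.equiv (Fin (d + 1)) ℝ).symm.toContinuousLinearMap.comp
    (ContinuousLinearMap.pi fun i => EuclideanSpace.proj (Fin.castSucc i))

/-- The last coordinate. -/
def euLast (d : ℕ) : Eu (d + 1) →L[ℝ] ℝ := EuclideanSpace.proj (Fin.last (d + 1))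

/-- The last basis vector. -/
def lastVec (d : ℕ) : Eu (d + 1) := EuclideanSpace.single (Fin.last (d + 1)) 1

/-- Append a zero coordinate. -/
def euLift (d : ℕ) : Eu d →L[ℝ] Eu (d + 1) :=
  (EuclideanSpace.equiv (Fin (d + 2)) ℝ).symm.toContinuousLinearMap.comp
    (ContinuousLinearMap.pi
      (Fin.lastCases 0 fun i => (EuclideanSpace.proj i : Eu d →L[ℝ] ℝ)))

theorem euInit_apply (d : ℕ) (x : Eu (d + 1)) (i : Fin (d + 1)) :
    euInit d x i = x (Fin.castSucc i) := rfl

theorem euLast_apply (d : ℕ) (x : Eu (d + 1)) : euLast d x = x (Fin.last (d + 1)) := rfl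

theorem euLift_castSucc (d : ℕ) (x : Eu d) (i : Fin (d + 1)) :
    euLift d x (Fin.castSucc i) = x i := by
  simp [euLift]

theorem euLift_last (d : ℕ) (x : Eu d) : euLift d x (Fin.last (d + 1)) = 0 := by
  simp [euLift]

@[simp] theorem euInit_euLift (d : ℕ) (x : Eu d) : euInit d (euLift d x) = x := by
  ext i; rw [euInit_apply, euLift_castSucc]

@[simp] theorem euLast_euLift (d : ℕ) (x : Eu d) : euLast d (euLift d x) = 0 := euLift_last d x

@[simp] theorem euInit_lastVec (d : ℕ) : euInit d (lastVec d) = 0 := by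
  ext i; simp [euInit_apply, lastVec, (Fin.castSucc_lt_last i).ne]

@[simp] theorem euLast_lastVec (d : ℕ) : euLast d (lastVec d) = 1 := by
  simp [euLast_apply, lastVec]

theorem norm_lastVec (d : ℕ) : ‖lastVec d‖ = 1 := by simp [lastVec]

theorem euLift_euInit_add (d : ℕ) (x : Eu (d + 1)) :
    euLift d (euInit d x) + euLast d x • lastVec d = x := by
  ext i
  refine Fin.lastCases ?_ (fun i => ?_) i
  · simp [euLift_last, euLast_apply, lastVec]
  · simp [euLift_castSucc, euInit_apply, lastVec, (Fin.castSucc_lt_last i).ne]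

theorem eu_ext {d : ℕ} {x y : Eu (d + 1)} (h : euInit d x = euInit d y)
    (h' : euLast d x = euLast d y) : x = y := by
  rw [← euLift_euInit_add d x, h, h', euLift_euInit_add]

theorem abs_euLast_le (d : ℕ) (x : Eu (d + 1)) : |euLast d x| ≤ ‖x‖ :=
  PiLp.norm_apply_le x _

theorem norm_euLift (d : ℕ) (x : Eu d) : ‖euLift d x‖ = ‖x‖ := by
  rw [EuclideanSpace.norm_eq, EuclideanSpace.norm_eq, Fin.sum_univ_castSucc]
  simp [euLift_castSucc, euLift_last]

theorem continuous_susp {T : Type*} [TopologicalSpace T] [CompactSpace T] {d : ℕ}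
    (G : C(T × Sph d, PuncturedEu d)) : Continuous fun q : T × Eu (d + 1) =>
      euLift d (‖euInit d q.2‖ • (G (q.1, toSph (euInit d q.2)) : Eu d)) +
        euLast d q.2 • lastVec d := by
  have hG : Continuous fun q => (G q : Eu d) := continuous_subtype_val.comp G.continuous
  obtain ⟨C, hC⟩ := (isCompact_range hG).isBounded.exists_norm_le
  have h1 := (continuous_norm_smul_toSph hG fun q => hC _ ⟨q, rfl⟩).comp
    (continuous_fst.prodMk ((euInit d).continuous.comp continuous_snd) :
      Continuous fun q : T × Eu (d + 1) => (q.1, euInit d q.2))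
  exact ((euLift d).continuous.comp h1).add (by fun_prop)

theorem susp_ne_zero {d : ℕ} (g : Sph d → PuncturedEu d) (x : Sph (d + 1)) :
    euLift d (‖euInit d x‖ • (g (toSph (euInit d x)) : Eu d)) + euLast d x • lastVec d ≠ 0 :=
  fun h => by
    have h1 := congrArg (euLast d) h
    have h2 := congrArg (euInit d) h
    simp only [map_add, map_smul, euLast_euLift, euInit_euLift, euInit_lastVec, euLast_lastVec,
      smul_eq_mul, mul_one, mul_zero, smul_zero, add_zero, zero_add, map_zero, smul_eq_zero,
      norm_eq_zero, (g _).2, or_false] at h1 h2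
    exact Sph.coe_ne_zero x (eu_ext (by rw [h2, map_zero]) (by rw [h1, map_zero]))

/-- The suspension of a family of maps of the sphere into punctured space. -/
def suspFamily {T : Type*} [TopologicalSpace T] [CompactSpace T] {d : ℕ}
    (G : C(T × Sph d, PuncturedEu d)) : C(T × Sph (d + 1), PuncturedEu (d + 1)) :=
  ⟨fun q => ⟨_, susp_ne_zero (fun p => G (q.1, p)) q.2⟩, Continuous.subtype_mk
    ((continuous_susp G).comp (continuous_fst.prodMk (continuous_subtype_val.comp continuous_snd) :
      Continuous fun q : T × Sph (d + 1) => (q.1, (q.2 : Eu (d + 1))))) _⟩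

/-- The suspension of a map of the sphere into punctured space. -/
def susp {d : ℕ} (g : C(Sph d, PuncturedEu d)) : C(Sph (d + 1), PuncturedEu (d + 1)) :=
  (suspFamily (T := Unit) (g.comp ContinuousMap.snd)).comp
    ((ContinuousMap.const _ ()).prodMk (.id _))

theorem coe_susp {d : ℕ} (g : C(Sph d, PuncturedEu d)) (x : Sph (d + 1)) :
    (susp g x : Eu (d + 1)) =
      euLift d (‖euInit d x‖ • (g (toSph (euInit d x)) : Eu d)) + euLast d x • lastVec d := rfl

theorem susp_homotopic {d : ℕ} {g h : C(Sph d, PuncturedEu d)} (H : g.Homotopic h) :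
    (susp g).Homotopic (susp h) := by
  obtain ⟨H⟩ := H
  refine ⟨⟨suspFamily H.toContinuousMap, fun x => Subtype.ext ?_, fun x => Subtype.ext ?_⟩⟩
  · change euLift d (‖euInit d x‖ • (H (0, toSph (euInit d x)) : Eu d)) + _ = _
    rw [H.apply_zero]; rfl
  · change euLift d (‖euInit d x‖ • (H (1, toSph (euInit d x)) : Eu d)) + _ = _
    rw [H.apply_one]; rfl

theorem onPlane_windMap_smul {m : ℕ} (k : ℤ) {t : ℝ} (ht : 0 ≤ t) (x : Eu (m + 1)) :
    onPlane m (windMap k) (t • x) = t • onPlane m (windMap k) x := by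
  simp only [onPlane, map_smul, windMap_smul k ht, smul_add, ← smul_sub]

theorem norm_smul_toSph' {n : ℕ} (x : Eu n) : ‖x‖ • (toSph x : Eu n) = x := by
  rcases eq_or_ne x 0 with rfl | hx
  · simp
  · exact norm_smul_toSph hx

theorem coe_windSph (m : ℕ) (k : ℤ) (x : Sph (m + 1)) :
    (windSph m k x : Eu (m + 1)) = onPlane m (windMap k) x := rfl

theorem planeIncl_apply (m : ℕ) (z : ℂ) (i : Fin (m + 1 + 1)) :
    planeIncl m z i = (if i = 0 then z.re else 0) + if i = 1 then z.im else 0 := by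
  simp [planeIncl]

theorem euLift_planeIncl (m : ℕ) (z : ℂ) :
    euLift (m + 1) (planeIncl m z) = planeIncl (m + 1) z := by
  ext i
  refine Fin.lastCases ?_ (fun i => ?_) i
  · have h0 : Fin.last (m + 2) ≠ 0 := by rw [Ne, Fin.ext_iff]; simp
    have h1 : Fin.last (m + 2) ≠ 1 := by rw [Ne, Fin.ext_iff]; simp
    rw [euLift_last, planeIncl_apply, if_neg h0, if_neg h1, add_zero]
  · have h0 : Fin.castSucc i = 0 ↔ i = 0 := by rw [Fin.ext_iff, Fin.ext_iff]; rfl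
    have h1 : Fin.castSucc i = 1 ↔ i = 1 := by rw [Fin.ext_iff, Fin.ext_iff]; simp
    rw [euLift_castSucc, planeIncl_apply, planeIncl_apply]
    simp only [h0, h1]

theorem planeProj_euInit (m : ℕ) (x : Eu (m + 1 + 1)) :
    planeProj m (euInit (m + 1) x) = planeProj (m + 1) x := by
  simp [planeProj, euInit_apply]

theorem susp_windSph (m : ℕ) (k : ℤ) : susp (windSph m k) = windSph (m + 1) k := by
  ext1 x
  apply Subtype.ext
  rw [coe_susp, coe_windSph, coe_windSph, ← onPlane_windMap_smul k (norm_nonneg _),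
    norm_smul_toSph', onPlane, onPlane, map_add, euLift_planeIncl, planeProj_euInit]
  refine (add_right_comm _ _ _).trans ?_
  exact congrArg (· + _) (euLift_euInit_add (m + 1) x)

/-- A map respecting the poles is homotopic to the suspension of its restriction to the equator. -/
theorem exists_homotopic_susp_of_poles {d : ℕ} (f : C(Sph (d + 1), PuncturedEu (d + 1)))
    (hf : ∀ x, euInit d (f x) = 0 → 0 < euLast d (f x) * euLast d x) :
    ∃ g, (susp g).Homotopic f := by
  let g : C(Sph d, PuncturedEu d) :=
    ⟨fun p => ⟨euInit d (f ⟨euLift d p, by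
      rw [mem_sphere_zero_iff_norm, norm_euLift, Sph.norm_coe]⟩), fun h => by
      have := hf _ h
      simp at this⟩, by
      refine Continuous.subtype_mk ((euInit d).continuous.comp (continuous_subtype_val.comp
        (f.continuous.comp (Continuous.subtype_mk (by fun_prop) _)))) _⟩
  let f1 : C(Sph (d + 1), PuncturedEu (d + 1)) :=
    ⟨fun x => ⟨euLift d (euInit d (f x)) + euLast d x • lastVec d, fun h => by
      have h1 := congrArg (euLast d) h
      have h2 := congrArg (euInit d) h
      simp at h1 h2
      have := hf x h2
      rw [h1] at this
      simp at this⟩, Continuous.subtype_mk (by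
        have := continuous_subtype_val.comp f.continuous
        have h2 := (euInit d).continuous.comp this
        have h3 := (euLift d).continuous.comp h2
        exact h3.add (by fun_prop)) _⟩
  have hf1 : ∀ x, (f1 x : Eu (d + 1)) = euLift d (euInit d (f x)) + euLast d x • lastVec d :=
    fun _ => rfl
  refine ⟨g, (PuncturedEu.homotopic_of_segment _ f1 fun x t ht h => ?_).trans
    (PuncturedEu.homotopic_of_segment _ _ fun x t ht h => ?_)⟩
  · have h1 := congrArg (euLast d) h
    have h2 := congrArg (euInit d) h
    rw [coe_susp, hf1] at h1 h2
    simp only [map_add, map_smul, euLast_euLift, euInit_euLift, euInit_lastVec, euLast_lastVec,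
      smul_eq_mul, mul_one, mul_zero, smul_zero, add_zero, zero_add, map_zero, ← add_mul,
      sub_add_cancel, one_mul] at h1 h2
    have hx : euLift d (euInit d x) = x := by
      have := euLift_euInit_add d x
      rwa [h1, zero_smul, add_zero] at this
    have hn : ‖euInit d x‖ = 1 := by rw [← norm_euLift, hx, Sph.norm_coe]
    have hg : (g (toSph (euInit d x)) : Eu d) = euInit d (f x) := by
      change euInit d (f ⟨euLift d (toSph (euInit d x)), _⟩) = _
      congr 3
      apply Subtype.ext
      have := norm_smul_toSph' (euInit d x)
      rw [hn, one_smul] at this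
      simp only [this, hx]
    rw [hn, hg, one_smul, ← add_smul, sub_add_cancel, one_smul] at h2
    have := hf x h2
    rw [h1, mul_zero] at this
    exact lt_irrefl _ this
  · have h1 := congrArg (euLast d) h
    have h2 := congrArg (euInit d) h
    rw [hf1] at h1 h2
    simp only [map_add, map_smul, euLast_euLift, euInit_euLift, euInit_lastVec, euLast_lastVec,
      smul_eq_mul, mul_one, smul_zero, add_zero, zero_add, map_zero, ← add_smul,
      sub_add_cancel, one_smul] at h1 h2
    have := hf x h2
    rcases ht.1.eq_or_lt with rfl | ht0
    · simp only [sub_zero, one_mul, zero_mul, add_zero] at h1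
      rw [h1, mul_zero] at this
      exact lt_irrefl _ this
    · have h3 : (1 - t) * euLast d x ^ 2 + t * (euLast d (f x) * euLast d x) = 0 := by
        linear_combination euLast d x * h1
      have := mul_nonneg (sub_nonneg.2 ht.2) (sq_nonneg (euLast d x))
      have := mul_pos ht0 ‹0 < euLast d (f x) * euLast d x›
      linarith

theorem toSph_smul {n : ℕ} {c : ℝ} (hc : 0 < c) (x : Eu n) : toSph (c • x) = toSph x := by
  rcases eq_or_ne x 0 with rfl | hx
  · simp
  · ext1
    rw [coe_toSph (smul_ne_zero hc.ne' hx), coe_toSph hx, norm_smul, Real.norm_of_nonneg hc.le,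
      smul_smul, mul_inv, mul_right_comm, inv_mul_cancel₀ hc.ne', one_mul]

/-- Almost every direction has only finitely many preimages under a nonvanishing `C¹` map of the
sphere. -/
theorem exists_null_finite_ray {n : ℕ} {F : Eu n → Eu n} (hF : ContDiff ℝ 1 F)
    (hF0 : ∀ p : Sph n, F p ≠ 0) : ∃ N : Set (Eu n), volume N = 0 ∧
      ∀ y ∉ N, y ≠ 0 → {p : Sph n | ∃ c : ℝ, 0 < c ∧ F p = c • y}.Finite := by
  set Θ : Eu n → Eu n := fun x => ‖x‖ • F (‖x‖⁻¹ • x) with hΘ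
  have hd : ∀ x ∈ ({0}ᶜ : Set (Eu n)), DifferentiableAt ℝ Θ x := fun x hx =>
    ((contDiffAt_norm ℝ hx).differentiableAt one_ne_zero).smul
      (((hF.differentiable one_ne_zero) _).comp x (hasFDerivAt_inv_norm_smul hx))
  refine ⟨_, addHaar_image_critical_eq_zero volume hd, fun y hy hy0 => ?_⟩
  have hFc : Continuous fun p : Sph n => ‖F p‖ :=
    (hF.continuous.comp continuous_subtype_val).norm
  obtain ⟨p₀, -, hp₀⟩ := isCompact_univ.exists_isMinOn ⟨toSph 0, mem_univ _⟩ hFc.continuousOn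
  obtain ⟨p₁, -, hp₁⟩ := isCompact_univ.exists_isMaxOn ⟨toSph 0, mem_univ _⟩ hFc.continuousOn
  have hb := norm_pos_iff.2 (hF0 p₀)
  have hn : ∀ x, x ≠ 0 → ‖Θ x‖ = ‖x‖ * ‖F (toSph x)‖ := fun x hx => by
    rw [coe_toSph hx, hΘ]; simp only [norm_smul, norm_norm]
  have hfin : {x : Eu n | x ≠ 0 ∧ Θ x = y}.Finite := by
    by_contra hinf
    obtain ⟨z, -, hz⟩ := Set.Infinite.exists_accPt_of_subset_isCompact hinf
      (isCompact_closedBall (0 : Eu n) (‖y‖ / ‖F p₀‖)) fun x ⟨hx0, hx⟩ => by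
        rw [mem_closedBall_zero_iff, le_div_iff₀ hb, ← hx, hn x hx0]
        exact mul_le_mul_of_nonneg_left (hp₀ (mem_univ _)) (norm_nonneg _)
    rw [accPt_iff_frequently_nhdsNE] at hz
    rcases eq_or_ne z 0 with rfl | hz0
    · have h1 : ∀ᶠ x : Eu n in 𝓝 0, ‖x‖ * ‖F p₁‖ < ‖y‖ := by
        have : Continuous fun x : Eu n => ‖x‖ * ‖F p₁‖ := by fun_prop
        exact this.continuousAt.eventually_lt continuousAt_const (by simpa)
      obtain ⟨x, ⟨hx0, hx⟩, hx1⟩ := (hz.and_eventually (h1.filter_mono nhdsWithin_le_nhds)).exists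
      rw [← hx, hn x hx0] at hx1
      exact (mul_le_mul_of_nonneg_left (hp₁ (mem_univ (toSph x))) (norm_nonneg x)).not_gt hx1
    · have hzy : Θ z = y := by
        by_contra hne
        have h1 := ((hd z hz0).continuousAt.eventually_ne hne).filter_mono
          (nhdsWithin_le_nhds (s := {z}ᶜ))
        obtain ⟨x, ⟨-, hx⟩, hx1⟩ := (hz.and_eventually h1).exists
        exact hx1 hx
      have hdet : (fderiv ℝ Θ z).det ≠ 0 := fun h => hy ⟨z, ⟨hz0, h⟩, hzy⟩
      have h1 : ∀ᶠ x in 𝓝[≠] z, Θ x ≠ y := (hd z hz0).hasFDerivAt.eventually_ne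
        ⟨_, ((fderiv ℝ Θ z).toContinuousLinearEquivOfDetNeZero hdet).antilipschitz⟩
      obtain ⟨x, ⟨-, hx⟩, hx1⟩ := (hz.and_eventually h1).exists
      exact hx1 hx
  refine (hfin.image toSph).subset ?_
  rintro p ⟨c, hc, hp⟩
  have hp0 := Sph.coe_ne_zero p
  refine ⟨c⁻¹ • p, ⟨smul_ne_zero (inv_ne_zero hc.ne') hp0, ?_⟩, ?_⟩
  · have h1 : ‖c⁻¹ • (p : Eu n)‖ = c⁻¹ := by
      rw [norm_smul, Sph.norm_coe, mul_one, Real.norm_of_nonneg (inv_nonneg.2 hc.le)]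
    simp only [hΘ]
    rw [h1, smul_smul, inv_inv, mul_inv_cancel₀ hc.ne', one_smul, hp, smul_smul,
      inv_mul_cancel₀ hc.ne', one_smul]
  · rw [toSph_smul (inv_pos.2 hc), toSph_coe]

/-- Up to homotopy, the poles have only finitely many preimages. -/
theorem exists_homotopic_finite_poles {d : ℕ} (f : C(Sph (d + 1), PuncturedEu (d + 1))) :
    ∃ g : C(Sph (d + 1), PuncturedEu (d + 1)), g.Homotopic f ∧
      {p | euInit d (g p) = 0}.Finite := by
  have hfc : Continuous fun p => (f p : Eu (d + 1)) := continuous_subtype_val.comp f.continuous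
  obtain ⟨p₀, -, hp₀⟩ := isCompact_univ.exists_isMinOn ⟨toSph 0, mem_univ _⟩
    hfc.norm.continuousOn
  obtain ⟨F, hF, hFf⟩ := Sph.exists_contDiff_approx hfc (norm_pos_iff.2 (f p₀).2)
  have hFf' : ∀ p : Sph (d + 1), ‖F p - f p‖ < ‖(f p : Eu (d + 1))‖ := fun p =>
    (hFf p).trans_le (hp₀ (mem_univ p))
  have hF0 : ∀ p : Sph (d + 1), F p ≠ 0 := fun p h => by
    have := hFf' p
    rw [h, zero_sub, norm_neg] at this
    exact lt_irrefl _ this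
  obtain ⟨N, hN, hNf⟩ := exists_null_finite_ray hF hF0
  obtain ⟨N', hN', hNf'⟩ := exists_null_finite_ray hF.neg fun p => neg_ne_zero.2 (hF0 p)
  obtain ⟨y, hyb, hy⟩ := Measure.exists_mem_notMem_of_measure_zero volume
    (isOpen_ball (x := lastVec d) (ε := 1 / 4)) (nonempty_ball.2 (by norm_num))
    (measure_union_null hN hN')
  rw [mem_union, not_or] at hy
  rw [mem_ball, dist_eq_norm] at hyb
  have hyn : 3 / 4 < ‖y‖ := by
    have := norm_sub_norm_le (lastVec d) y
    rw [norm_lastVec, norm_sub_rev] at this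
    linarith
  have hy0 : y ≠ 0 := norm_pos_iff.1 (by linarith)
  let M : Eu (d + 1) →L[ℝ] Eu (d + 1) :=
    ContinuousLinearMap.id ℝ _ + ((‖y‖ ^ 2)⁻¹ • innerSL ℝ y).smulRight (lastVec d - y)
  have hMa : ∀ z, M z = z + ((‖y‖ ^ 2)⁻¹ * ⟪y, z⟫) • (lastVec d - y) := fun z => rfl
  have hMy : M y = lastVec d := by
    rw [hMa, real_inner_self_eq_norm_sq, inv_mul_cancel₀ (by positivity), one_smul]; abel
  have hMlt : ∀ z, z ≠ 0 → ‖M z - z‖ < ‖z‖ := fun z hz => by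
    have hz' := norm_pos_iff.2 hz
    rw [hMa, add_sub_cancel_left, norm_smul, norm_mul, norm_inv, norm_pow, norm_norm]
    have h1 : ‖lastVec d - y‖ < 1 / 4 := by rwa [norm_sub_rev]
    have h2 := norm_inner_le_norm (𝕜 := ℝ) y z
    have h3 : (‖y‖ ^ 2)⁻¹ * ‖⟪y, z⟫‖ ≤ (4 / 3) * ‖z‖ := by
      rw [inv_mul_le_iff₀ (by positivity)]
      have h4 : ‖y‖ * ‖z‖ * 1 ≤ ‖y‖ * ‖z‖ * (4 / 3 * ‖y‖) :=
        mul_le_mul_of_nonneg_left (by linarith) (by positivity)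
      linarith
    nlinarith [norm_nonneg (lastVec d - y)]
  have hM0 : ∀ z, z ≠ 0 → M z ≠ 0 := fun z hz h => by
    have := hMlt z hz
    rw [h, zero_sub, norm_neg] at this
    exact lt_irrefl _ this
  have hMinj : Function.Injective M := (injective_iff_map_eq_zero M).2 fun z hz => by
    by_contra h
    exact hM0 z h hz
  let F₁ := Sph.toPunctured F (hF.continuous.comp continuous_subtype_val) hF0
  let F₂ := Sph.toPunctured (fun p => M (F p))
    (M.continuous.comp (hF.continuous.comp continuous_subtype_val)) fun p => hM0 _ (hF0 p)
  refine ⟨F₂, ((PuncturedEu.homotopic_of_norm_sub_lt f F₁ hFf').trans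
    (PuncturedEu.homotopic_of_norm_sub_lt F₁ F₂ fun p => hMlt _ (hF0 p))).symm, ?_⟩
  refine ((hNf y hy.1 hy0).union (hNf' y hy.2 hy0)).subset fun p hp => ?_
  have h1 : M (F p) = euLast d (M (F p)) • M y :=
    eu_ext (by rw [map_smul, hMy, euInit_lastVec, smul_zero]; exact hp)
      (by rw [map_smul, hMy, euLast_lastVec, smul_eq_mul, mul_one])
  rw [← map_smul] at h1
  have h2 := hMinj h1
  rcases lt_trichotomy (euLast d (M (F p))) 0 with h | h | h
  · refine Or.inr ⟨-euLast d (M (F p)), neg_pos.2 h, ?_⟩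
    rw [neg_smul, ← h2]
  · rw [h, zero_smul] at h2
    exact absurd h2 (hF0 p)
  · exact Or.inl ⟨_, h, h2⟩

theorem exists_notMem_span_pair {d : ℕ} (hd : 1 ≤ d) {F : Set (Eu (d + 1))} (hF : F.Finite) :
    ∃ e ∈ ball (lastVec d) (1 / 2), ∀ a ∈ F, ∀ b ∈ F, e ∉ Submodule.span ℝ {a, b} := by
  obtain ⟨e, he, heN⟩ := Measure.exists_mem_notMem_of_measure_zero volume
    (isOpen_ball (x := lastVec d) (ε := 1 / 2)) (nonempty_ball.2 (by norm_num))
    (s := ⋃ a ∈ F, ⋃ b ∈ F, (Submodule.span ℝ {a, b} : Set (Eu (d + 1)))) <| by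
      refine (measure_biUnion_null_iff hF.countable).2 fun a _ =>
        (measure_biUnion_null_iff hF.countable).2 fun b _ => ?_
      refine Measure.addHaar_submodule volume _ fun h => ?_
      classical
      have h1 := finrank_span_finset_le_card (R := ℝ) ({a, b} : Finset (Eu (d + 1)))
      rw [Finset.coe_pair, Set.finrank, h, finrank_top, finrank_euclideanSpace_fin] at h1
      have := Finset.card_le_two (a := a) (b := b)
      omega
  refine ⟨e, he, fun a ha b hb h => heN ?_⟩
  simp only [mem_iUnion]
  exact ⟨a, ha, b, hb, h⟩

/-- Two finite sets of vectors whose horizontal directions differ can be separated by a positively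
homogeneous graph. -/
theorem exists_homogeneous_separation {d : ℕ} {A B : Set (Eu (d + 1))} (hA : A.Finite)
    (hB : B.Finite) (hne : ∀ x ∈ A ∪ B, euInit d x ≠ 0)
    (hsep : ∀ a ∈ A, ∀ b ∈ B, toSph (euInit d a) ≠ toSph (euInit d b)) :
    ∃ φ : Eu d → ℝ, Continuous φ ∧ (∀ c v, 0 < c → φ (c • v) = c * φ v) ∧ φ 0 = 0 ∧
      (∀ a ∈ A, φ (euInit d a) < euLast d a) ∧ ∀ b ∈ B, euLast d b < φ (euInit d b) := by
  obtain ⟨C, hC⟩ := ((hA.union hB).image fun x => |euLast d x| / ‖euInit d x‖).bddAbove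
  have hC' : ∀ x ∈ A ∪ B, |euLast d x| < ‖euInit d x‖ * (C + 1) := fun x hx => by
    have h1 := norm_pos_iff.2 (hne x hx)
    have h2 : |euLast d x| / ‖euInit d x‖ ≤ C := hC ⟨x, hx, rfl⟩
    rw [div_le_iff₀ h1] at h2
    linarith
  obtain ⟨h, h0, h1, h01⟩ := exists_continuous_zero_one_of_isClosed
    (hA.image fun a => toSph (euInit d a)).isClosed (hB.image fun a => toSph (euInit d a)).isClosed
    (disjoint_left.2 (by rintro _ ⟨a, ha, rfl⟩ ⟨b, hb, hab⟩; exact hsep a ha b hb hab.symm))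
  have hω : Continuous fun q : Unit × Sph d => (C + 1) * (2 * h q.2 - 1) := by fun_prop
  refine ⟨fun v => ‖v‖ * ((C + 1) * (2 * h (toSph v) - 1)), ?_, fun c v hc => ?_, by simp,
    fun a ha => ?_, fun b hb => ?_⟩
  · have hb : ∀ q : Unit × Sph d, ‖(C + 1) * (2 * h q.2 - 1)‖ ≤ |C + 1| := fun q => ?_
    · have h2 := (continuous_norm_smul_toSph hω hb).comp
        (Continuous.prodMk_right () : Continuous fun v : Eu d => ((), v))
      simpa only [Function.comp_def, smul_eq_mul] using h2
    rw [Real.norm_eq_abs, abs_mul]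
    refine mul_le_of_le_one_right (abs_nonneg _) (abs_le.2 ?_)
    constructor <;> linarith [(h01 q.2).1, (h01 q.2).2]
  · simp only
    rw [toSph_smul hc, norm_smul, Real.norm_of_nonneg hc.le, mul_assoc]
  · have := (abs_lt.1 (hC' a (Or.inl ha))).1
    have h2 : h (toSph (euInit d a)) = 0 := h0 ⟨a, ha, rfl⟩
    simp only [h2]
    linarith
  · have := (abs_lt.1 (hC' b (Or.inr hb))).2
    have h2 : h (toSph (euInit d b)) = 1 := h1 ⟨b, hb, rfl⟩
    simp only [h2]
    linarith

/-- Two disjoint finite subsets of the sphere can be moved to opposite hemispheres. -/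
theorem exists_homotopic_incl_hemispheres {d : ℕ} (hd : 1 ≤ d) {A B : Set (Sph (d + 1))}
    (hA : A.Finite) (hB : B.Finite) (hAB : Disjoint A B) :
    ∃ D : C(Sph (d + 1), PuncturedEu (d + 1)), D.Homotopic (Sph.incl (d + 1)) ∧
      (∀ x, toSph (D x : Eu (d + 1)) ∈ A → 0 < euLast d x) ∧
      ∀ x, toSph (D x : Eu (d + 1)) ∈ B → euLast d x < 0 := by
  obtain ⟨e, he, hspan⟩ := exists_notMem_span_pair hd
    ((hA.union hB).image ((↑) : Sph (d + 1) → Eu (d + 1)))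
  have hspan : ∀ a ∈ A ∪ B, ∀ b ∈ A ∪ B,
      e ∉ Submodule.span ℝ {(a : Eu (d + 1)), (b : Eu (d + 1))} :=
    fun a ha b hb => hspan a ⟨a, ha, rfl⟩ b ⟨b, hb, rfl⟩
  rw [mem_ball, dist_eq_norm] at he
  let M : Eu (d + 1) →L[ℝ] Eu (d + 1) :=
    ContinuousLinearMap.id ℝ _ + (euLast d).smulRight (e - lastVec d)
  have hMa : ∀ z, M z = z + euLast d z • (e - lastVec d) := fun z => rfl
  have hMe : M (lastVec d) = e := by rw [hMa, euLast_lastVec, one_smul]; abel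
  have hMlt : ∀ z, z ≠ 0 → ‖M z - z‖ < ‖z‖ := fun z hz => by
    have hz' := norm_pos_iff.2 hz
    rw [hMa, add_sub_cancel_left, norm_smul, Real.norm_eq_abs]
    nlinarith [abs_euLast_le d z, norm_nonneg (e - lastVec d), abs_nonneg (euLast d z)]
  have hM0 : ∀ z, z ≠ 0 → M z ≠ 0 := fun z hz h => by
    have := hMlt z hz
    rw [h, zero_sub, norm_neg] at this
    exact lt_irrefl _ this
  have hMinj : Function.Injective M := (injective_iff_map_eq_zero M).2 fun z hz => by
    by_contra h
    exact hM0 z h hz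
  have hpre : ∀ {s : Set (Sph (d + 1))}, s.Finite → (M ⁻¹' (Subtype.val '' s)).Finite := fun hs =>
    (hs.image _).preimage hMinj.injOn
  have hver : ∀ z, euInit d z = 0 → M z = euLast d z • e := fun z hz => by
    rw [← hMe, ← map_smul]
    congr 1
    exact eu_ext (by rw [hz, map_smul, euInit_lastVec, smul_zero])
      (by rw [map_smul, euLast_lastVec, smul_eq_mul, mul_one])
  have hmem : ∀ z {a b : Eu (d + 1)}, euLast d z • e ∈ Submodule.span ℝ {a, b} →
      e ∉ Submodule.span ℝ {a, b} → euLast d z = 0 := fun z a b h h' => by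
    by_contra h0
    exact h' ((Submodule.smul_mem_iff _ h0).1 h)
  have hne : ∀ x ∈ M ⁻¹' (Subtype.val '' A) ∪ M ⁻¹' (Subtype.val '' B), euInit d x ≠ 0 :=
    fun x hx h0 => by
      rw [← preimage_union, ← image_union] at hx
      obtain ⟨a, ha, hax⟩ := hx
      have h1 := hver x h0
      have h2 : euLast d x = 0 := hmem x
        (by rw [← h1, ← hax]; exact Submodule.subset_span (mem_insert _ _)) (hspan a ha a ha)
      rw [h2, zero_smul, ← hax] at h1
      exact Sph.coe_ne_zero a h1
  obtain ⟨φ, hφ, hφs, hφ0, hφA, hφB⟩ := exists_homogeneous_separation (hpre hA) (hpre hB) hne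
    fun x hx x' hx' h => by
      have hi := norm_pos_iff.2 (hne x (Or.inl hx))
      have hi' := norm_pos_iff.2 (hne x' (Or.inr hx'))
      obtain ⟨a, ha, hax⟩ := hx
      obtain ⟨b, hb, hbx⟩ := hx'
      set r := ‖euInit d x‖ * ‖euInit d x'‖⁻¹
      have hz : euInit d (x - r • x') = 0 := by
        rw [map_sub, map_smul, mul_smul, ← coe_toSph (norm_pos_iff.1 hi'), ← h,
          norm_smul_toSph (norm_pos_iff.1 hi), sub_self]
      have h1 : (a : Eu (d + 1)) - r • (b : Eu (d + 1)) = euLast d (x - r • x') • e := by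
        rw [← hver _ hz, map_sub, map_smul, hax, hbx]
      have h2 := hmem (x - r • x') (a := a) (b := b) (by
        rw [← h1]
        exact sub_mem (Submodule.subset_span (mem_insert _ _))
          (Submodule.smul_mem _ _ (Submodule.subset_span (mem_insert_of_mem _ rfl))))
        (hspan a (Or.inl ha) b (Or.inr hb))
      rw [h2, zero_smul, sub_eq_zero] at h1
      refine disjoint_left.1 hAB ha ?_
      rwa [← toSph_coe a, h1, toSph_smul (mul_pos hi (inv_pos.2 hi')), toSph_coe]
  have hS : ∀ x : Eu (d + 1), euInit d (x + φ (euInit d x) • lastVec d) = euInit d x := fun x => by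
    simp
  have hSt : ∀ (x : Sph (d + 1)) (t : ℝ), (x : Eu (d + 1)) + (t * φ (euInit d x)) • lastVec d ≠ 0 :=
    fun x t h => by
      have h1 : euInit d (x : Eu (d + 1)) = 0 := by simpa using congrArg (euInit d) h
      rw [h1, hφ0, mul_zero, zero_smul, add_zero] at h
      exact Sph.coe_ne_zero x h
  have hS0 : ∀ x : Sph (d + 1), (x : Eu (d + 1)) + φ (euInit d x) • lastVec d ≠ 0 := fun x => by
    simpa using hSt x 1
  have hSc : Continuous fun x : Sph (d + 1) => (x : Eu (d + 1)) + φ (euInit d x) • lastVec d := by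
    fun_prop
  let S := Sph.toPunctured (fun x => x + φ (euInit d x) • lastVec d) hSc hS0
  let D := Sph.toPunctured (fun x => M (x + φ (euInit d x) • lastVec d))
    (M.continuous.comp hSc) fun x => hM0 _ (hS0 x)
  have hlast : ∀ (x y : Sph (d + 1)), toSph (D x : Eu (d + 1)) = y → ∃ z, M z = y ∧ ∃ s : ℝ, 0 < s ∧
      euLast d x = s * (euLast d z - φ (euInit d z)) := fun x y hy => by
    have hp := norm_pos_iff.2 (D x).2
    have hx : (x : Eu (d + 1)) + φ (euInit d x) • lastVec d =
        ‖(D x : Eu (d + 1))‖ • ‖(D x : Eu (d + 1))‖⁻¹ •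
          ((x : Eu (d + 1)) + φ (euInit d x) • lastVec d) := by
      rw [smul_smul, mul_inv_cancel₀ hp.ne', one_smul]
    refine ⟨‖(D x : Eu (d + 1))‖⁻¹ • (x + φ (euInit d x) • lastVec d), ?_,
      ‖(D x : Eu (d + 1))‖, hp, ?_⟩
    · rw [map_smul, ← hy, coe_toSph (D x).2]; rfl
    · rw [mul_sub, ← hφs _ _ hp, ← map_smul, ← smul_eq_mul, ← map_smul, ← hx, hS]
      simp
  refine ⟨D, ((PuncturedEu.homotopic_of_segment (Sph.incl (d + 1)) S fun x t _ => ?_).trans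
    (PuncturedEu.homotopic_of_norm_sub_lt S D fun x => hMlt _ (hS0 x))).symm,
    fun x hx => ?_, fun x hx => ?_⟩
  · convert hSt x t using 1
    simp only [Sph.incl, S, Sph.toPunctured, ContinuousMap.coe_mk]
    module
  · obtain ⟨z, hz, s, hs, h⟩ := hlast x _ rfl
    rw [h]
    exact mul_pos hs (sub_pos.2 (hφA z ⟨_, hx, hz.symm⟩))
  · obtain ⟨z, hz, s, hs, h⟩ := hlast x _ rfl
    rw [h]
    exact mul_neg_of_pos_of_neg hs (sub_neg.2 (hφB z ⟨_, hx, hz.symm⟩))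

theorem exists_homotopic_susp {d : ℕ} (hd : 1 ≤ d) (f : C(Sph (d + 1), PuncturedEu (d + 1))) :
    ∃ g : C(Sph d, PuncturedEu d), (susp g).Homotopic f := by
  obtain ⟨g, hgf, hg⟩ := exists_homotopic_finite_poles f
  obtain ⟨D, hD, hDA, hDB⟩ := exists_homotopic_incl_hemispheres hd
    (A := {p | euInit d (g p) = 0 ∧ 0 < euLast d (g p)})
    (B := {p | euInit d (g p) = 0 ∧ euLast d (g p) < 0})
    (hg.subset fun _ h => h.1) (hg.subset fun _ h => h.1)
    (disjoint_left.2 fun _ h h' => h.2.not_gt h'.2)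
  obtain ⟨k, hk⟩ := exists_homotopic_susp_of_poles
    ((g.comp (PuncturedEu.toSph (d + 1))).comp D) fun x hx => by
      rcases lt_trichotomy (euLast d (((g.comp (PuncturedEu.toSph (d + 1))).comp D) x)) 0
        with h | h | h
      · exact mul_pos_of_neg_of_neg h (hDB x ⟨hx, h⟩)
      · exact absurd (eu_ext (by rw [hx, map_zero]) (by rw [h, map_zero]))
          (((g.comp (PuncturedEu.toSph (d + 1))).comp D) x).2
      · exact mul_pos h (hDA x ⟨hx, h⟩)
  refine ⟨k, hk.trans ?_⟩
  have h1 := (ContinuousMap.Homotopic.refl (g.comp (PuncturedEu.toSph (d + 1)))).comp hD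
  rw [ContinuousMap.comp_assoc g _ (Sph.incl _), PuncturedEu.toSph_comp_incl, ContinuousMap.comp_id] at h1
  exact h1.trans hgf

/-- Every map of the sphere to punctured space is homotopic to a winding map. -/
theorem exists_homotopic_windSph : ∀ (m : ℕ) (f : C(Sph (m + 1), PuncturedEu (m + 1))),
    ∃ k, (windSph m k).Homotopic f
  | 0, f => exists_homotopic_windSph_zero f
  | m + 1, f => by
    obtain ⟨g, hg⟩ := exists_homotopic_susp (Nat.le_add_left 1 m) f
    obtain ⟨k, hk⟩ := exists_homotopic_windSph m g
    refine ⟨k, ?_⟩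
    rw [← susp_windSph]
    exact (susp_homotopic hk).trans hg

/-- A continuous map `f : S^n → S^n` (`n ≥ 2`) satisfying
`f(-p) = R_p f(p)` for all `p` is not homotopic to a constant map; if moreover `n` is odd,
it is homotopic to the identity. -/
theorem reflection_symmetric_map_not_nullhomotopic (n : ℕ) (hn : 2 ≤ n)
    (f : C(Sph n, Sph n))
    (hf : ∀ p : Sph n, (f (-p) : Eu n) = Refl (p : Eu n) (f p : Eu n)) :
    (∀ y : Sph n, ¬ f.Homotopic (ContinuousMap.const (Sph n) y)) ∧
      (Odd n → f.Homotopic (ContinuousMap.id (Sph n))) := by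
  obtain ⟨m, rfl⟩ : ∃ m, n = m + 1 := ⟨n - 1, by omega⟩
  refine ⟨not_homotopic_const_of_equivariant hf, fun hodd => ?_⟩
  obtain ⟨k, hk⟩ := exists_homotopic_windSph m ((Sph.incl (m + 1)).comp f)
  have h1 := eq_one_of_homotopic_windSph hf hodd hk
  rw [h1, windSph_one] at hk
  exact (Sph.homotopic_iff _ _).2 (by simpa using hk.symm)

end
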